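/- Let G be a unicyclic graph. Then dim(G) = L(G) + max{0, 2−b(G)} + Δ, where Δ = 0 if G is ABC-negative and Δ = 1 if G is ABC-positive. -/

import Mathlib

open SimpleGraph

section Defs

variable {V : Type*}

/-- Distance from a vertex `s` to an edge `e`: the minimum of the distances to its endpoints. -/
noncomputable def edgeDist (G : SimpleGraph V) (s : V) (e : Sym2 V) : ℕ :=
  Sym2.lift ⟨fun u w => min (G.dist s u) (G.dist s w), fun u w => min_comm _ _⟩ e

/-- `S` is a vertex metric generator of `G`. -/
def IsVertexMG (G : SimpleGraph V) (S : Set V) : Prop :=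
  ∀ u v : V, u ≠ v → ∃ s ∈ S, G.dist s u ≠ G.dist s v

/-- `S` is an edge metric generator of `G`. -/
def IsEdgeMG (G : SimpleGraph V) (S : Set V) : Prop :=
  ∀ e ∈ G.edgeSet, ∀ f ∈ G.edgeSet, e ≠ f → ∃ s ∈ S, edgeDist G s e ≠ edgeDist G s f

/-- The vertex metric dimension of `G`. -/
noncomputable def metricDim (G : SimpleGraph V) : ℕ :=
  sInf {n | ∃ S : Finset V, S.card = n ∧ IsVertexMG G ↑S}

/-- The edge metric dimension of `G`. -/
noncomputable def edgeMetricDim (G : SimpleGraph V) : ℕ :=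
  sInf {n | ∃ S : Finset V, S.card = n ∧ IsEdgeMG G ↑S}

/-- `G` is unicyclic: connected, contains a cycle, and any two cycles have the same edges. -/
def IsUnicyclic (G : SimpleGraph V) : Prop :=
  G.Connected ∧ (∃ (u : V) (w : G.Walk u u), w.IsCycle) ∧
    ∀ (u u' : V) (w : G.Walk u u) (w' : G.Walk u' u'), w.IsCycle → w'.IsCycle →
      ∀ e, e ∈ w.edges ↔ e ∈ w'.edges

/-- `vc : ZMod g → V` is a labelling `v_0 v_1 ⋯ v_{g-1}` of a cycle of length `g` in `G`. -/
def IsCycleLabelling (G : SimpleGraph V) (g : ℕ) (vc : ZMod g → V) : Prop :=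
  Function.Injective vc ∧ ∀ i : ZMod g, G.Adj (vc i) (vc (i + 1))

/-- The set of edges of the cycle `C`. -/
def cycleEdges (g : ℕ) (vc : ZMod g → V) : Set (Sym2 V) :=
  {e | ∃ i : ZMod g, e = s(vc i, vc (i + 1))}

/-- The graph `G - E(C)`. -/
def offCycle (G : SimpleGraph V) (g : ℕ) (vc : ZMod g → V) : SimpleGraph V :=
  G.deleteEdges (cycleEdges g vc)

/-- `x` belongs to `T_{v_i}`, the connected component of `G - E(C)` containing `v_i`. -/
def inTree (G : SimpleGraph V) (g : ℕ) (vc : ZMod g → V) (i : ZMod g) (x : V) : Prop :=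
  (offCycle G g vc).Reachable (vc i) x

/-- The vertex `v_i` of the cycle is `S`-active: `T_{v_i}` contains a vertex of `S`. -/
def SActive (G : SimpleGraph V) (g : ℕ) (vc : ZMod g → V) (S : Set V) (i : ZMod g) : Prop :=
  ∃ s ∈ S, inTree G g vc i s

/-- `a_S(C)`: the number of `S`-active vertices on the cycle. -/
noncomputable def aS (G : SimpleGraph V) (g : ℕ) (vc : ZMod g → V) (S : Set V) : ℕ :=
  {i : ZMod g | SActive G g vc S i}.ncard

/-- `S` is biactive: `a_S(C) ≥ 2`. -/
def Biactive (G : SimpleGraph V) (g : ℕ) (vc : ZMod g → V) (S : Set V) : Prop :=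
  2 ≤ aS G g vc S

variable [Fintype V] [DecidableEq V]

/-- `t = u_1 u_2 ⋯ u_k` is a thread hanging at the vertex `v`. -/
def IsThreadAt (G : SimpleGraph V) [DecidableRel G.Adj] (v : V) (t : List V) : Prop :=
  t ≠ [] ∧ t.Nodup ∧ v ∉ t ∧ 3 ≤ G.degree v ∧ List.Chain' G.Adj t ∧
    (∀ u ∈ t.head?, G.Adj v u) ∧ (∀ u ∈ t.getLast?, G.degree u = 1) ∧
    ∀ u ∈ t.dropLast, G.degree u = 2

/-- The thread `t` is `S`-free: it contains no vertex of `S`. -/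
def SFree (S : Set V) (t : List V) : Prop := ∀ u ∈ t, u ∉ S

/-- `S` is branch-resolving: for every vertex, all threads hanging at it except possibly
one contain a vertex of `S` (i.e. at most one thread at each vertex is `S`-free). -/
def BranchResolving (G : SimpleGraph V) [DecidableRel G.Adj] (S : Set V) : Prop :=
  ∀ v : V, ∀ t₁ t₂ : List V, IsThreadAt G v t₁ → IsThreadAt G v t₂ → t₁ ≠ t₂ →
    (∃ s ∈ S, s ∈ t₁) ∨ (∃ s ∈ S, s ∈ t₂)

/-- `ℓ(v)`: the number of threads hanging at `v`. -/
noncomputable def numThreads (G : SimpleGraph V) [DecidableRel G.Adj] (v : V) : ℕ :=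
  {t : List V | IsThreadAt G v t}.ncard

/-- `L(G) = Σ (ℓ(v) - 1)` (truncated subtraction makes the sum run exactly over the
vertices with `ℓ(v) > 1`). -/
noncomputable def LG (G : SimpleGraph V) [DecidableRel G.Adj] : ℕ :=
  ∑ v : V, (numThreads G v - 1)

/-- `x` is a branching vertex of the unicyclic graph with cycle `vc`. -/
def Branching (G : SimpleGraph V) [DecidableRel G.Adj] (g : ℕ) (vc : ZMod g → V) (x : V) :
    Prop :=
  (x ∉ Set.range vc ∧ 3 ≤ G.degree x) ∨ (x ∈ Set.range vc ∧ 4 ≤ G.degree x)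

/-- The cycle vertex `v_i` is branch-active: `T_{v_i}` contains a branching vertex. -/
def BranchActive (G : SimpleGraph V) [DecidableRel G.Adj] (g : ℕ) (vc : ZMod g → V)
    (i : ZMod g) : Prop :=
  ∃ x, inTree G g vc i x ∧ Branching G g vc x

/-- `b(G)`: the number of branch-active vertices on the cycle. -/
noncomputable def bG (G : SimpleGraph V) [DecidableRel G.Adj] (g : ℕ) (vc : ZMod g → V) : ℕ :=
  {i : ZMod g | BranchActive G g vc i}.ncard

/-- `k = max { i : v_i is S-active }` for the labelling `vc` (indices taken in `[0, g-1]`). -/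
noncomputable def kOf (G : SimpleGraph V) (g : ℕ) (vc : ZMod g → V) (S : Set V) : ℕ :=
  sSup {n : ℕ | n < g ∧ SActive G g vc S (n : ZMod g)}

/-- The labelling `vc` of the cycle is canonical with respect to `S`: `v_0` is `S`-active
and `k` is as small as possible among all labellings of the cycle with `v_0` `S`-active. -/
def Canonical (G : SimpleGraph V) (g : ℕ) (vc : ZMod g → V) (S : Set V) : Prop :=
  IsCycleLabelling G g vc ∧ SActive G g vc S 0 ∧
    ∀ vc' : ZMod g → V, IsCycleLabelling G g vc' → Set.range vc' = Set.range vc →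
      SActive G g vc' S 0 → kOf G g vc S ≤ kOf G g vc' S

/-- Configuration 𝒜 : `a_S(C) = 2`, `g` even and `k = g/2`. -/
def ConfigA (G : SimpleGraph V) (g : ℕ) (vc : ZMod g → V) (S : Set V) : Prop :=
  aS G g vc S = 2 ∧ Even g ∧ kOf G g vc S = g / 2

/-- Configuration ℬ : `k ≤ ⌊g/2⌋ - 1` and an `S`-free thread hangs at `v_i` for some
`i ∈ [k, ⌊g/2⌋-1] ∪ [⌈g/2⌉+k+1, g-1] ∪ {0}`. -/
def ConfigB (G : SimpleGraph V) [DecidableRel G.Adj] (g : ℕ) (vc : ZMod g → V) (S : Set V) :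
    Prop :=
  kOf G g vc S ≤ g / 2 - 1 ∧
    ∃ i : ℕ, ((kOf G g vc S ≤ i ∧ i ≤ g / 2 - 1) ∨
        ((g + 1) / 2 + kOf G g vc S + 1 ≤ i ∧ i ≤ g - 1) ∨ i = 0) ∧
      ∃ t : List V, IsThreadAt G (vc (i : ZMod g)) t ∧ SFree S t

/-- Configuration 𝒞 : `a_S(C) = 2`, `g` even, `k ≤ g/2` and an `S`-free thread of length
`≥ g/2 - k` hangs at `v_i` for some `i ∈ [0, k]`. -/
def ConfigC (G : SimpleGraph V) [DecidableRel G.Adj] (g : ℕ) (vc : ZMod g → V) (S : Set V) :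
    Prop :=
  aS G g vc S = 2 ∧ Even g ∧ kOf G g vc S ≤ g / 2 ∧
    ∃ i : ℕ, i ≤ kOf G g vc S ∧
      ∃ t : List V, IsThreadAt G (vc (i : ZMod g)) t ∧ SFree S t ∧
        g / 2 - kOf G g vc S ≤ t.length

/-- Configuration 𝒟 : `k ≤ ⌈g/2⌉ - 1` and an `S`-free thread hangs at `v_i` for some
`i ∈ [k, ⌈g/2⌉-1] ∪ [⌊g/2⌋+k+1, g-1] ∪ {0}`. -/
def ConfigD (G : SimpleGraph V) [DecidableRel G.Adj] (g : ℕ) (vc : ZMod g → V) (S : Set V) :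
    Prop :=
  kOf G g vc S ≤ (g + 1) / 2 - 1 ∧
    ∃ i : ℕ, ((kOf G g vc S ≤ i ∧ i ≤ (g + 1) / 2 - 1) ∨
        (g / 2 + kOf G g vc S + 1 ≤ i ∧ i ≤ g - 1) ∨ i = 0) ∧
      ∃ t : List V, IsThreadAt G (vc (i : ZMod g)) t ∧ SFree S t

/-- Configuration ℰ : `a_S(C) = 2` and an `S`-free thread of length `≥ ⌊g/2⌋ - k + 1`
hangs at `v_i` with `i ∈ [0, k]`; moreover if `g` is even an `S`-free thread hangs at
`v_j` with `j = g/2 + k - i`. -/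
def ConfigE (G : SimpleGraph V) [DecidableRel G.Adj] (g : ℕ) (vc : ZMod g → V) (S : Set V) :
    Prop :=
  aS G g vc S = 2 ∧
    ∃ i : ℕ, i ≤ kOf G g vc S ∧
      (∃ t : List V, IsThreadAt G (vc (i : ZMod g)) t ∧ SFree S t ∧
        g / 2 - kOf G g vc S + 1 ≤ t.length) ∧
      (Even g → ∃ t' : List V,
        IsThreadAt G (vc ((g / 2 + kOf G g vc S - i : ℕ) : ZMod g)) t' ∧ SFree S t')

/-- `G` contains configuration 𝒜 with respect to `S` (evaluated on a canonical labelling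
of the cycle given by `vc`). -/
def ContainsA (G : SimpleGraph V) (g : ℕ) (vc : ZMod g → V) (S : Set V) : Prop :=
  ∃ vc' : ZMod g → V, IsCycleLabelling G g vc' ∧ Set.range vc' = Set.range vc ∧
    Canonical G g vc' S ∧ ConfigA G g vc' S

/-- `G` contains configuration ℬ with respect to `S`. -/
def ContainsB (G : SimpleGraph V) [DecidableRel G.Adj] (g : ℕ) (vc : ZMod g → V)
    (S : Set V) : Prop :=
  ∃ vc' : ZMod g → V, IsCycleLabelling G g vc' ∧ Set.range vc' = Set.range vc ∧
    Canonical G g vc' S ∧ ConfigB G g vc' S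

/-- `G` contains configuration 𝒞 with respect to `S`. -/
def ContainsC (G : SimpleGraph V) [DecidableRel G.Adj] (g : ℕ) (vc : ZMod g → V)
    (S : Set V) : Prop :=
  ∃ vc' : ZMod g → V, IsCycleLabelling G g vc' ∧ Set.range vc' = Set.range vc ∧
    Canonical G g vc' S ∧ ConfigC G g vc' S

/-- `G` contains configuration 𝒟 with respect to `S`. -/
def ContainsD (G : SimpleGraph V) [DecidableRel G.Adj] (g : ℕ) (vc : ZMod g → V)
    (S : Set V) : Prop :=
  ∃ vc' : ZMod g → V, IsCycleLabelling G g vc' ∧ Set.range vc' = Set.range vc ∧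
    Canonical G g vc' S ∧ ConfigD G g vc' S

/-- `G` contains configuration ℰ with respect to `S`. -/
def ContainsE (G : SimpleGraph V) [DecidableRel G.Adj] (g : ℕ) (vc : ZMod g → V)
    (S : Set V) : Prop :=
  ∃ vc' : ZMod g → V, IsCycleLabelling G g vc' ∧ Set.range vc' = Set.range vc ∧
    Canonical G g vc' S ∧ ConfigE G g vc' S

/-- `G` contains one of the configurations 𝒜, ℬ, 𝒞 with respect to `S`. -/
def ContainsABC (G : SimpleGraph V) [DecidableRel G.Adj] (g : ℕ) (vc : ZMod g → V)
    (S : Set V) : Prop :=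
  ContainsA G g vc S ∨ ContainsB G g vc S ∨ ContainsC G g vc S

/-- `G` contains one of the configurations 𝒜, 𝒟, ℰ with respect to `S`. -/
def ContainsADE (G : SimpleGraph V) [DecidableRel G.Adj] (g : ℕ) (vc : ZMod g → V)
    (S : Set V) : Prop :=
  ContainsA G g vc S ∨ ContainsD G g vc S ∨ ContainsE G g vc S

/-- `S` is a smallest branch-resolving set of `G`. -/
def SmallestBR (G : SimpleGraph V) [DecidableRel G.Adj] (S : Finset V) : Prop :=
  BranchResolving G ↑S ∧ ∀ S' : Finset V, BranchResolving G ↑S' → S.card ≤ S'.card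

/-- `S` is a smallest biactive branch-resolving set of `G`. -/
def SmallestBBR (G : SimpleGraph V) [DecidableRel G.Adj] (g : ℕ) (vc : ZMod g → V)
    (S : Finset V) : Prop :=
  BranchResolving G ↑S ∧ Biactive G g vc ↑S ∧
    ∀ S' : Finset V, BranchResolving G ↑S' → Biactive G g vc ↑S' → S.card ≤ S'.card

/-- `G` is 𝒜ℬ𝒞-negative. -/
def ABCneg (G : SimpleGraph V) [DecidableRel G.Adj] (g : ℕ) (vc : ZMod g → V) : Prop :=
  ∃ S : Finset V, SmallestBBR G g vc S ∧ ¬ ContainsABC G g vc ↑S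

/-- `G` is 𝒜𝒟ℰ-negative. -/
def ADEneg (G : SimpleGraph V) [DecidableRel G.Adj] (g : ℕ) (vc : ZMod g → V) : Prop :=
  ∃ S : Finset V, SmallestBBR G g vc S ∧ ¬ ContainsADE G g vc ↑S

end Defs

section CycleCoordinates

variable {V : Type*} {G : SimpleGraph V} {g : ℕ}

/-- The distance between the positions `i, j < g` on a cycle of length `g`. -/
def cycDist (g i j : ℕ) : ℕ := min (i - j + (j - i)) (g - (i - j + (j - i)))

/-- `u 0, …, u (g - 1)` is a cycle of the connected graph `G`, the vertices are classified by
`pos` according to the cycle vertex below which they hang, and all edges inside a class are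
bridges. -/
structure CycleCoords (G : SimpleGraph V) (g : ℕ) (u : ℕ → V) (pos : V → ℕ) : Prop where
  connected : G.Connected
  three_le : 3 ≤ g
  pos_lt : ∀ x, pos x < g
  pos_cycle : ∀ i < g, pos (u i) = i
  adj_cycle : ∀ i, i + 1 < g → G.Adj (u i) (u (i + 1))
  adj_last : G.Adj (u (g - 1)) (u 0)
  eq_of_adj : ∀ x y, G.Adj x y → pos x ≠ pos y →
    x = u (pos x) ∧ y = u (pos y) ∧ cycDist g (pos x) (pos y) = 1
  bridge : ∀ x y, G.Adj x y → pos x = pos y → G.IsBridge s(x, y)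

lemma exists_walk_cycleEdges {vc : ZMod g → V} (hvc : IsCycleLabelling G g vc) (i : ZMod g)
    (n : ℕ) : ∃ w : G.Walk (vc i) (vc (i + n)), ∀ e ∈ w.edges, e ∈ cycleEdges g vc := by
  induction n with
  | zero => exact ⟨Walk.nil.copy rfl (by simp), by simp⟩
  | succ n ih =>
    obtain ⟨w, hw⟩ := ih
    refine ⟨(w.concat (hvc.2 (i + n))).copy rfl (by push_cast; ring_nf), ?_⟩
    intro e he
    simp only [Walk.edges_copy, Walk.edges_concat, List.concat_eq_append, List.mem_append,
      List.mem_singleton] at he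
    rcases he with he | rfl
    · exact hw e he
    · exact ⟨i + n, rfl⟩

lemma exists_isCycle_of_mem_cycleEdges (hg : 3 ≤ g) {vc : ZMod g → V}
    (hvc : IsCycleLabelling G g vc) {e : Sym2 V} (he : e ∈ cycleEdges g vc) :
    ∃ (x : V) (w : G.Walk x x), w.IsCycle ∧ e ∈ w.edges ∧ ∀ f ∈ w.edges, f ∈ cycleEdges g vc := by
  obtain ⟨i, rfl⟩ := he
  have : NeZero g := ⟨by omega⟩
  have natCast_ne : ∀ n : ℕ, 0 < n → n < g → (n : ZMod g) ≠ 0 := by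
    intro n h0 hn h
    rw [ZMod.natCast_eq_zero_iff] at h
    exact absurd (Nat.le_of_dvd h0 h) (by omega)
  set H : SimpleGraph V := fromEdgeSet (cycleEdges g vc) with hH
  have hadj : ∀ j, H.Adj (vc j) (vc (j + 1)) := fun j => by
    rw [hH, fromEdgeSet_adj]
    exact ⟨⟨j, rfl⟩, (hvc.2 j).ne⟩
  have hreach : ∀ n : ℕ, n < g →
      (H.deleteEdges {s(vc i, vc (i + 1))}).Reachable (vc (i + 1)) (vc (i + 1 + n)) := by
    intro n
    induction n with
    | zero => intro _; simp
    | succ n ih =>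
      intro hn
      refine (ih (by omega)).trans (Adj.reachable ?_)
      rw [deleteEdges_adj]
      refine ⟨by simpa [add_assoc] using hadj (i + 1 + n), ?_⟩
      simp only [Set.mem_singleton_iff, Sym2.eq_iff, not_or, not_and]
      constructor
      · intro h _
        have h := hvc.1 h
        apply natCast_ne (n + 1) (by omega) hn
        push_cast
        linear_combination h
      · intro h h'
        have h := hvc.1 h
        have h' := hvc.1 h'
        apply natCast_ne 2 (by omega) (by omega)
        push_cast at h' ⊢
        linear_combination h' - h
  have hnb : ¬ H.IsBridge s(vc i, vc (i + 1)) := by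
    rw [isBridge_iff, not_not]
    have := hreach (g - 1) (by omega)
    have e : i + 1 + ((g - 1 : ℕ) : ZMod g) = i := by
      rw [Nat.cast_sub (by omega)]; simp
    rw [e] at this
    exact this.symm
  rw [isBridge_iff_forall_cycle_notMem (hadj i)] at hnb
  push Not at hnb
  obtain ⟨x, w, hw, hmem⟩ := hnb
  have hle : H ≤ G := by
    intro a b hab
    rw [hH, fromEdgeSet_adj] at hab
    obtain ⟨⟨j, hj⟩, _⟩ := hab
    rw [← mem_edgeSet, hj]
    exact hvc.2 j
  refine ⟨x, w.mapLe hle, hw.mapLe hle, by simpa using hmem, fun f hf => ?_⟩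
  have hf : f ∈ H.edgeSet := w.edges_subset_edgeSet (by simpa using hf)
  rw [hH, edgeSet_fromEdgeSet] at hf
  exact hf.1

lemma mem_cycleEdges_iff (hG : IsUnicyclic G) (hg : 3 ≤ g) {vc : ZMod g → V}
    (hvc : IsCycleLabelling G g vc) (e : Sym2 V) :
    e ∈ cycleEdges g vc ↔ ∃ (x : V) (w : G.Walk x x), w.IsCycle ∧ e ∈ w.edges := by
  constructor
  · intro he
    obtain ⟨x, w, hw, hew, -⟩ := exists_isCycle_of_mem_cycleEdges hg hvc he
    exact ⟨x, w, hw, hew⟩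
  · rintro ⟨x, w, hw, hew⟩
    obtain ⟨x', w', hw', -, h⟩ := exists_isCycle_of_mem_cycleEdges hg hvc
      (e := s(vc 0, vc (0 + 1))) ⟨0, rfl⟩
    exact h e ((hG.2.2 x x' w w' hw hw' e).1 hew)

lemma offCycle_eq (hG : IsUnicyclic G) (hg : 3 ≤ g) {vc vc' : ZMod g → V}
    (hvc : IsCycleLabelling G g vc) (hvc' : IsCycleLabelling G g vc') :
    offCycle G g vc = offCycle G g vc' := by
  have : cycleEdges g vc = cycleEdges g vc' := by
    ext e
    rw [mem_cycleEdges_iff hG hg hvc, mem_cycleEdges_iff hG hg hvc']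
  rw [offCycle, offCycle, this]

lemma isBridge_of_notMem_cycleEdges (hG : IsUnicyclic G) (hg : 3 ≤ g) {vc : ZMod g → V}
    (hvc : IsCycleLabelling G g vc) {x y : V} (h : G.Adj x y) (hxy : s(x, y) ∉ cycleEdges g vc) :
    G.IsBridge s(x, y) := by
  rw [isBridge_iff_forall_cycle_notMem h]
  intro z w hw hmem
  exact hxy ((mem_cycleEdges_iff hG hg hvc _).2 ⟨z, w, hw, hmem⟩)

lemma eq_of_reachable_offCycle (hG : IsUnicyclic G) (hg : 3 ≤ g) {vc : ZMod g → V}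
    (hvc : IsCycleLabelling G g vc) {i j : ZMod g}
    (h : (offCycle G g vc).Reachable (vc i) (vc j)) : i = j := by
  have : NeZero g := ⟨by omega⟩
  by_contra hij
  obtain ⟨p, hp⟩ := h.exists_isPath
  have hne : vc i ≠ vc j := fun h => hij (hvc.1 h)
  have key : ∀ (a b : V) (p : (offCycle G g vc).Walk a b), p.IsPath → a = vc i → b = vc j →
      False := by
    intro a b p hp ha hb
    cases p with
    | nil => exact hne (ha.symm.trans hb)
    | @cons _ y _ hadj q =>
      subst ha hb
      rw [offCycle, deleteEdges_adj] at hadj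
      have hbr := isBridge_of_notMem_cycleEdges hG hg hvc hadj.1 hadj.2
      rw [isBridge_iff_forall_walk_mem_edges] at hbr
      obtain ⟨w, hw⟩ := exists_walk_cycleEdges hvc i (j - i).val
      have hcast : i + ((j - i).val : ZMod g) = j := by simp
      have hle : offCycle G g vc ≤ G := deleteEdges_le _
      have := hbr ((w.copy rfl (by rw [hcast])).append (q.mapLe hle).reverse)
      simp only [Walk.edges_append, Walk.edges_copy, Walk.edges_reverse, List.mem_append,
        List.mem_reverse] at this
      rcases this with h | h
      · exact hadj.2 (hw _ h)
      · rw [Walk.cons_isPath_iff] at hp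
        apply hp.2
        have h : s(vc i, y) ∈ q.edges := by simpa using h
        exact Walk.fst_mem_support_of_mem_edges _ h
  exact key _ _ p hp rfl rfl

lemma exists_inTree (hG : IsUnicyclic G) (vc : ZMod g → V) (x : V) :
    ∃ i, inTree G g vc i x := by
  have key : ∀ (a b : V) (_ : G.Walk a b), (∃ i, inTree G g vc i a) → ∃ i, inTree G g vc i b := by
    intro a b p
    induction p with
    | nil => exact id
    | @cons a c b hadj q ih =>
      rintro ⟨i, hi⟩
      apply ih
      by_cases hc : s(a, c) ∈ cycleEdges g vc
      · obtain ⟨j, hj⟩ := hc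
        rw [Sym2.eq_iff] at hj
        rcases hj with ⟨-, rfl⟩ | ⟨-, rfl⟩
        · exact ⟨j + 1, Reachable.refl _⟩
        · exact ⟨j, Reachable.refl _⟩
      · refine ⟨i, hi.trans (Adj.reachable ?_)⟩
        rw [offCycle, deleteEdges_adj]
        exact ⟨hadj, hc⟩
  obtain ⟨w⟩ := hG.1.preconnected (vc 0) x
  exact key _ _ w ⟨0, Reachable.refl _⟩

lemma exists_pos (hG : IsUnicyclic G) (hg : 3 ≤ g) {vc : ZMod g → V}
    (hvc : IsCycleLabelling G g vc) :
    ∃ pos : V → ℕ, CycleCoords G g (fun n => vc n) pos ∧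
      ∀ (n : ℕ) (x : V), n < g → (inTree G g vc n x ↔ pos x = n) := by
  have : NeZero g := ⟨by omega⟩
  choose f hf using exists_inTree hG vc
  have huniq : ∀ i x, inTree G g vc i x → f x = i := fun i x h =>
    eq_of_reachable_offCycle hG hg hvc ((hf x).trans h.symm)
  have hcyc : ∀ i, f (vc i) = i := fun i => huniq i _ (Reachable.refl _)
  have hsucc : ∀ i : ZMod g, ((i + 1).val = i.val + 1 ∧ i.val + 1 < g) ∨
      ((i + 1).val = 0 ∧ i.val + 1 = g) := by
    intro i
    have hi := ZMod.val_lt i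
    have h : (i + 1).val = (i.val + 1) % g := by
      rw [← ZMod.val_natCast]; simp
    rcases Nat.lt_or_ge (i.val + 1) g with h' | h'
    · rw [Nat.mod_eq_of_lt h'] at h; exact Or.inl ⟨h, h'⟩
    · have h'' : i.val + 1 = g := by omega
      rw [h'', Nat.mod_self] at h; exact Or.inr ⟨h, h''⟩
  refine ⟨fun x => (f x).val, ⟨hG.1, hg, fun x => ZMod.val_lt _, ?_, ?_, ?_, ?_, ?_⟩, ?_⟩
  · intro i hi
    simp [hcyc, ZMod.val_natCast, Nat.mod_eq_of_lt hi]
  · intro i _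
    simpa using hvc.2 (i : ZMod g)
  · have := hvc.2 ((g - 1 : ℕ) : ZMod g)
    rw [Nat.cast_sub (by omega)] at this ⊢
    simpa using this
  · intro x y hadj hne
    have hmem : s(x, y) ∈ cycleEdges g vc := by
      by_contra hc
      apply hne
      have : inTree G g vc (f x) y := (hf x).trans (Adj.reachable (by
        rw [offCycle, deleteEdges_adj]; exact ⟨hadj, hc⟩))
      simp only [huniq _ _ this]
    obtain ⟨i, hi⟩ := hmem
    rw [Sym2.eq_iff] at hi
    rcases hi with ⟨rfl, rfl⟩ | ⟨rfl, rfl⟩ <;> simp only [hcyc, ZMod.natCast_zmod_val, true_and] <;>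
      rcases hsucc i with h | h <;> simp only [cycDist] <;> omega
  · intro x y hadj heq
    refine isBridge_of_notMem_cycleEdges hG hg hvc hadj ?_
    rintro ⟨i, hi⟩
    rw [Sym2.eq_iff] at hi
    rcases hi with ⟨rfl, rfl⟩ | ⟨rfl, rfl⟩ <;> simp only [hcyc] at heq <;>
      rcases hsucc i with h | h <;> omega
  · intro n x hn
    constructor
    · intro h
      simp [huniq _ _ h, ZMod.val_natCast, Nat.mod_eq_of_lt hn]
    · rintro rfl
      simpa using hf x

end CycleCoordinates

section Distances

variable {V : Type*} {G : SimpleGraph V}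

lemma exists_adj_dist_eq (hc : G.Connected) {x y : V} (hne : x ≠ y) :
    ∃ z, G.Adj x z ∧ G.dist x y = G.dist z y + 1 := by
  obtain ⟨p, hp⟩ := hc.exists_walk_length_eq_dist x y
  cases p with
  | nil => exact absurd rfl hne
  | @cons _ z _ h q =>
    refine ⟨z, h, ?_⟩
    have h1 := dist_le q
    have h2 := hc.dist_triangle (u := x) (v := z) (w := y)
    rw [dist_eq_one_iff_adj.2 h] at h2
    rw [Walk.length_cons] at hp
    omega

lemma dist_le_succ_of_adj (hc : G.Connected) {x z : V} (h : G.Adj x z) (y : V) :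
    G.dist x y ≤ G.dist z y + 1 := by
  have h2 := hc.dist_triangle (u := x) (v := z) (w := y)
  rw [dist_eq_one_iff_adj.2 h] at h2
  omega

lemma le_length_of_bridge (hc : G.Connected) {w c : V} :
    ∀ {s y : V} (p : G.Walk s y), ¬ (G.deleteEdges {s(w, c)}).Reachable c s →
      (G.deleteEdges {s(w, c)}).Reachable c y → G.dist s w + 1 + G.dist c y ≤ p.length := by
  intro s y p
  induction p with
  | nil => exact fun h1 h2 => absurd h2 h1
  | @cons s z y hadj q ih =>
    intro hs hy
    rw [Walk.length_cons]
    by_cases hz : (G.deleteEdges {s(w, c)}).Reachable c z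
    · have he : s(s, z) = s(w, c) := by
        by_contra hne
        apply hs
        refine hz.trans (Adj.reachable ?_)
        rw [deleteEdges_adj]
        exact ⟨hadj.symm, fun h => hne (Sym2.eq_swap.trans h)⟩
      rw [Sym2.eq_iff] at he
      rcases he with ⟨rfl, rfl⟩ | ⟨rfl, -⟩
      · have := dist_le q
        rw [SimpleGraph.dist_self]
        omega
      · exact absurd (Reachable.refl _) hs
    · have h1 := ih hz hy
      have h2 := dist_le_succ_of_adj hc hadj w
      omega

lemma dist_bridge_or (hc : G.Connected) {w c : V} (hadj : G.Adj w c) (hb : G.IsBridge s(w, c))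
    (y : V) : G.dist w y = G.dist c y + 1 ∨ G.dist c y = G.dist w y + 1 := by
  have h1 := dist_le_succ_of_adj hc hadj y
  have h2 := dist_le_succ_of_adj hc hadj.symm y
  by_cases hy : (G.deleteEdges {s(w, c)}).Reachable c y
  · obtain ⟨p, hp⟩ := hc.exists_walk_length_eq_dist w y
    have := le_length_of_bridge hc p (fun h => hb h.symm) hy
    rw [SimpleGraph.dist_self] at this
    omega
  · obtain ⟨p, hp⟩ := hc.exists_walk_length_eq_dist y c
    have := le_length_of_bridge hc p hy (Reachable.refl _)
    rw [SimpleGraph.dist_self, dist_comm] at this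
    rw [dist_comm] at hp
    omega

/-- Every path from one side of a bridge to the other one uses the bridge. -/
lemma dist_across_bridge (hc : G.Connected) {w c s y : V}
    (hb : G.IsBridge s(w, c)) (hs : G.dist c s = G.dist w s + 1)
    (hy : G.dist w y = G.dist c y + 1) : G.dist s y = G.dist s w + 1 + G.dist c y := by
  have hs' : ¬ (G.deleteEdges {s(w, c)}).Reachable c s := by
    intro h
    obtain ⟨p, hp⟩ := hc.exists_walk_length_eq_dist w s
    have := le_length_of_bridge hc p (fun h => hb h.symm) h
    rw [SimpleGraph.dist_self] at this
    omega
  have hy' : (G.deleteEdges {s(w, c)}).Reachable c y := by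
    by_contra h
    obtain ⟨p, hp⟩ := hc.exists_walk_length_eq_dist y c
    have := le_length_of_bridge hc p h (Reachable.refl _)
    rw [SimpleGraph.dist_self, dist_comm] at this
    rw [dist_comm] at hp
    omega
  obtain ⟨p, hp⟩ := hc.exists_walk_length_eq_dist s y
  have h1 := le_length_of_bridge hc p hs' hy'
  have h2 := hc.dist_triangle (u := s) (v := w) (w := y)
  omega

/-- Distinct branches at a vertex are disjoint. -/
lemma eq_of_dist_bridge (hc : G.Connected) {w c c' y : V} (hadj : G.Adj w c)
    (hb : G.IsBridge s(w, c)) (hadj' : G.Adj w c') (hy : G.dist w y = G.dist c y + 1)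
    (hy' : G.dist w y = G.dist c' y + 1) : c = c' := by
  by_contra hne
  have hcc : G.dist c c' = G.dist w c' + 1 := by
    rcases dist_bridge_or hc hadj hb c' with h | h
    · rw [dist_eq_one_iff_adj.2 hadj'] at h
      exact absurd (hc.dist_eq_zero_iff.1 (by omega)) hne
    · exact h
  have h1 := dist_across_bridge hc hb hcc hy
  rw [dist_comm (u := c') (v := w), dist_eq_one_iff_adj.2 hadj'] at h1
  omega

end Distances

section CycleDistances

variable {V : Type*} {G : SimpleGraph V} {g : ℕ} {u : ℕ → V} {pos : V → ℕ}

/-- The distance from a vertex to the cycle. -/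
noncomputable def height (G : SimpleGraph V) (u : ℕ → V) (pos : V → ℕ) (x : V) : ℕ :=
  G.dist (u (pos x)) x

/-- `c` is a neighbour of `w` in the tree of `w` hanging at the cycle, farther from the cycle. -/
def IsChild (G : SimpleGraph V) (u : ℕ → V) (pos : V → ℕ) (w c : V) : Prop :=
  G.Adj w c ∧ pos w = pos c ∧ height G u pos c = height G u pos w + 1

namespace CycleCoords

lemma height_eq_zero (h : CycleCoords G g u pos) {x : V} :
    height G u pos x = 0 ↔ x = u (pos x) := by
  rw [height, h.connected.dist_eq_zero_iff, eq_comm]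

lemma height_cycle (h : CycleCoords G g u pos) {i : ℕ} (hi : i < g) :
    height G u pos (u i) = 0 := by
  rw [h.height_eq_zero, h.pos_cycle i hi]

lemma dist_gate (h : CycleCoords G g u pos) {x y : V} (hne : pos y ≠ pos x) :
    G.dist y x = G.dist y (u (pos x)) + height G u pos x := by
  have key : ∀ {a b : V} (p : G.Walk a b), pos a ≠ pos b →
      G.dist a (u (pos b)) + G.dist (u (pos b)) b ≤ p.length := by
    intro a b p
    induction p with
    | nil => exact fun h => absurd rfl h
    | @cons a z b hadj q ih =>
      intro hab
      rw [Walk.length_cons]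
      by_cases hz : pos z = pos b
      · obtain ⟨-, hz', -⟩ := h.eq_of_adj a z hadj (by rw [hz]; exact hab)
        rw [← hz, ← hz', dist_eq_one_iff_adj.2 hadj]
        have := dist_le q
        omega
      · have h1 := ih hz
        have h2 := dist_le_succ_of_adj h.connected hadj (u (pos b))
        omega
  obtain ⟨p, hp⟩ := h.connected.exists_walk_length_eq_dist y x
  have h1 := key p hne
  have h2 := h.connected.dist_triangle (u := y) (v := u (pos x)) (w := x)
  rw [height]
  omega

lemma dist_cycle_le (h : CycleCoords G g u pos) {i n : ℕ} (hi : i + n < g) :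
    G.dist (u i) (u (i + n)) ≤ n := by
  induction n with
  | zero => simp
  | succ n ih =>
    have h1 := ih (by omega)
    have h2 := h.connected.dist_triangle (u := u i) (v := u (i + n)) (w := u (i + (n + 1)))
    have h3 := dist_eq_one_iff_adj.2 (h.adj_cycle (i + n) (by omega))
    rw [add_assoc] at h3
    omega

lemma dist_cycle (h : CycleCoords G g u pos) {i j : ℕ} (hi : i < g) (hj : j < g) :
    G.dist (u i) (u j) = cycDist g i j := by
  have hlt : ∀ i j, i ≤ j → j < g → G.dist (u i) (u j) ≤ min (j - i) (g - (j - i)) := by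
    intro i j hij hj
    have h1 := h.dist_cycle_le (i := i) (n := j - i) (by omega)
    rw [Nat.add_sub_cancel' hij] at h1
    have h2 := h.dist_cycle_le (i := 0) (n := i) (by omega)
    have h3 := h.dist_cycle_le (i := j) (n := g - 1 - j) (by omega)
    have h4 := dist_eq_one_iff_adj.2 h.adj_last
    rw [show j + (g - 1 - j) = g - 1 by omega, dist_comm] at h3
    rw [zero_add] at h2
    have h5 := h.connected.dist_triangle (u := u (g - 1)) (v := u 0) (w := u i)
    have h6 := h.connected.dist_triangle (u := u j) (v := u (g - 1)) (w := u i)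
    rw [dist_comm (u := u j) (v := u i), dist_comm (u := u j) (v := u (g - 1))] at h6
    omega
  have hle : G.dist (u i) (u j) ≤ cycDist g i j := by
    rcases le_total i j with hij | hij
    · have := hlt i j hij hj
      simp only [cycDist]
      omega
    · have := hlt j i hij hi
      rw [dist_comm] at this
      simp only [cycDist]
      omega
  have key : ∀ {a b : V} (p : G.Walk a b), cycDist g (pos a) (pos b) ≤ p.length := by
    intro a b p
    induction p with
    | nil => simp [cycDist]
    | @cons a z b hadj q ih =>
      rw [Walk.length_cons]
      by_cases hz : pos a = pos z
      · rw [hz]; omega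
      · obtain ⟨-, -, h1⟩ := h.eq_of_adj a z hadj hz
        have ha := h.pos_lt a
        have hb := h.pos_lt b
        have hz := h.pos_lt z
        simp only [cycDist] at h1 ih ⊢
        omega
  obtain ⟨p, hp⟩ := h.connected.exists_walk_length_eq_dist (u i) (u j)
  have := key p
  rw [h.pos_cycle i hi, h.pos_cycle j hj] at this
  omega

lemma dist_of_pos_ne (h : CycleCoords G g u pos) {x y : V} (hne : pos x ≠ pos y) :
    G.dist x y = height G u pos x + cycDist g (pos x) (pos y) + height G u pos y := by
  have hx := h.pos_lt x
  have hy := h.pos_lt y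
  rw [h.dist_gate hne, dist_comm, h.dist_gate (y := u (pos y)) (x := x)
    (by rw [h.pos_cycle _ hy]; exact hne.symm), h.dist_cycle hy hx]
  simp only [cycDist]
  omega

lemma dist_cycle_vertex (h : CycleCoords G g u pos) {i : ℕ} (hi : i < g) (x : V) :
    G.dist x (u i) = height G u pos x + cycDist g (pos x) i := by
  by_cases hne : pos x = i
  · rw [hne, dist_comm, height, hne]
    simp [cycDist]
  · have hp := h.pos_cycle i hi
    rw [h.dist_of_pos_ne (by rw [hp]; exact hne), hp, h.height_cycle hi, add_zero]

lemma dist_le_height_add (h : CycleCoords G g u pos) {x y : V} (he : pos x = pos y) :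
    G.dist x y ≤ height G u pos x + height G u pos y := by
  have := h.connected.dist_triangle (u := x) (v := u (pos x)) (w := y)
  rw [dist_comm (u := x) (v := u (pos x))] at this
  rw [height, height, ← he]
  exact this

lemma pos_eq_of_adj (h : CycleCoords G g u pos) {w c : V} (hadj : G.Adj w c)
    (hc : c ≠ u (pos c)) : pos w = pos c := by
  by_contra hne
  exact hc (h.eq_of_adj w c hadj hne).2.1

lemma exists_adj_cycle (h : CycleCoords G g u pos) {i : ℕ} (hi : i < g) :
    ∃ j k, j < g ∧ k < g ∧ j ≠ k ∧ j ≠ i ∧ k ≠ i ∧ G.Adj (u i) (u j) ∧ G.Adj (u i) (u k) := by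
  have hg := h.three_le
  have hsucc : ∃ j, j < g ∧ G.Adj (u i) (u j) ∧ (j = i + 1 ∨ i = g - 1 ∧ j = 0) := by
    rcases Nat.lt_or_ge (i + 1) g with h' | h'
    · exact ⟨i + 1, h', h.adj_cycle i h', by omega⟩
    · have : i = g - 1 := by omega
      exact ⟨0, by omega, this ▸ h.adj_last, by omega⟩
  have hpred : ∃ j, j < g ∧ G.Adj (u i) (u j) ∧ (j + 1 = i ∨ i = 0 ∧ j = g - 1) := by
    rcases Nat.eq_zero_or_pos i with rfl | h'
    · exact ⟨g - 1, by omega, h.adj_last.symm, by omega⟩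
    · have := h.adj_cycle (i - 1) (by omega)
      rw [Nat.sub_add_cancel h'] at this
      exact ⟨i - 1, by omega, this.symm, by omega⟩
  obtain ⟨j, hj, hj', hj''⟩ := hsucc
  obtain ⟨k, hk, hk', hk''⟩ := hpred
  exact ⟨j, k, hj, hk, by omega, by omega, by omega, hj', hk'⟩

lemma height_adj (h : CycleCoords G g u pos) {w c : V} (hadj : G.Adj w c) (he : pos w = pos c) :
    height G u pos c = height G u pos w + 1 ∨ height G u pos w = height G u pos c + 1 := by
  have := dist_bridge_or h.connected hadj (h.bridge _ _ hadj he) (u (pos w))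
  rw [dist_comm, dist_comm (u := c)] at this
  rw [height, height, ← he]
  omega

/-- A vertex has at most one neighbour nearer to the cycle. -/
lemma parent_unique (h : CycleCoords G g u pos) {c w w' : V} (hw : IsChild G u pos w c)
    (hw' : IsChild G u pos w' c) : w = w' := by
  refine eq_of_dist_bridge h.connected (y := u (pos c)) hw.1.symm
    (h.bridge _ _ hw.1.symm hw.2.1.symm) hw'.1.symm ?_ ?_
  · have := hw.2.2
    rw [dist_comm, dist_comm (u := w)]
    rw [height, height, hw.2.1] at this
    exact this
  · have := hw'.2.2
    rw [dist_comm, dist_comm (u := w')]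
    rw [height, height, hw'.2.1] at this
    exact this

lemma ne_cycle_of_isChild (h : CycleCoords G g u pos) {w c : V} (hc : IsChild G u pos w c) :
    c ≠ u (pos c) := by
  intro he
  have := h.height_eq_zero.2 he
  have := hc.2.2
  omega

lemma isBridge_of_isChild (h : CycleCoords G g u pos) {w c : V} (hc : IsChild G u pos w c) :
    G.IsBridge s(w, c) :=
  h.bridge _ _ hc.1 hc.2.1

lemma isChild_or (h : CycleCoords G g u pos) {w c : V} (hadj : G.Adj w c)
    (he : pos w = pos c) : IsChild G u pos w c ∨ IsChild G u pos c w := by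
  rcases h.height_adj hadj he with h' | h'
  · exact Or.inl ⟨hadj, he, h'⟩
  · exact Or.inr ⟨hadj.symm, he.symm, h'⟩

/-- Every vertex beyond a child edge belongs to the same tree. -/
lemma branch_height (h : CycleCoords G g u pos) {w c y : V} (hc : IsChild G u pos w c)
    (hy : G.dist w y = G.dist c y + 1) :
    pos y = pos w ∧ height G u pos y = height G u pos w + 1 + G.dist c y := by
  have hr : G.dist c (u (pos w)) = G.dist w (u (pos w)) + 1 := by
    have := hc.2.2
    rw [height, height, ← hc.2.1] at this
    rw [dist_comm, dist_comm (u := w), this]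
  have h1 := dist_across_bridge h.connected (h.isBridge_of_isChild hc) hr hy
  have hpos : pos y = pos w := by
    by_contra hne
    have h2 := h.dist_gate (x := c) (y := y) (by rw [← hc.2.1]; exact hne)
    rw [← hc.2.1, dist_comm, dist_comm (u := y)] at h2
    omega
  refine ⟨hpos, ?_⟩
  rw [height, hpos, h1, height]

lemma exists_adj_not_isChild (h : CycleCoords G g u pos) (w : V) :
    ∃ z, G.Adj w z ∧ ¬ IsChild G u pos w z := by
  by_cases hw : w = u (pos w)
  · obtain ⟨j, -, hj, -, -, hji, -, hadj, -⟩ := h.exists_adj_cycle (h.pos_lt w)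
    refine ⟨u j, hw ▸ hadj, fun hc => hji ?_⟩
    have := hc.2.1
    rw [h.pos_cycle j hj] at this
    exact this.symm
  · obtain ⟨z, hz, hd⟩ := exists_adj_dist_eq h.connected hw
    refine ⟨z, hz, fun hc => ?_⟩
    have := hc.2.2
    rw [height, height, ← hc.2.1, dist_comm, dist_comm (v := w)] at this
    omega

end CycleCoords

end CycleDistances

section Threads

variable {V : Type*} {G : SimpleGraph V}

/-- `t` is a path that starts at a neighbour of `w`, avoids `w`, and has no further edges to
other vertices. -/
def IsTail (G : SimpleGraph V) : V → List V → Prop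
  | _, [] => False
  | w, [c] => G.Adj w c ∧ ∀ z, G.Adj c z → z = w
  | w, c :: c' :: r => G.Adj w c ∧ w ≠ c' ∧ (∀ z, G.Adj c z → z = w ∨ z = c') ∧
      IsTail G c (c' :: r)

lemma IsTail.adj {w c : V} {r : List V} (h : IsTail G w (c :: r)) : G.Adj w c := by
  cases r with
  | nil => exact h.1
  | cons c' r => exact h.1

lemma IsTail.ne_nil {w : V} {t : List V} (h : IsTail G w t) : t ≠ [] := by
  rintro rfl
  exact h

/-- A tail can only be reached through the vertex at which it hangs. -/
lemma IsTail.dist_getElem (hc : G.Connected) {w : V} {t : List V} (ht : IsTail G w t) {s : V}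
    (hs : s ∉ t) (n : ℕ) (hn : n < t.length) : G.dist s t[n] = G.dist s w + n + 1 := by
  induction t generalizing w n with
  | nil => exact absurd rfl ht.ne_nil
  | cons c r ih =>
    have hsc : c ≠ s := fun h => hs (h ▸ List.mem_cons_self)
    have h0 : G.dist s c = G.dist s w + 1 := by
      obtain ⟨z, hz, hd⟩ := exists_adj_dist_eq hc hsc
      rw [dist_comm, dist_comm (u := z)] at hd
      cases r with
      | nil => rw [hd, ht.2 z hz]
      | cons c' r =>
        obtain ⟨-, -, hnb, htail⟩ := ht
        rcases hnb z hz with rfl | rfl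
        · exact hd
        · have := ih htail (fun h => hs (List.mem_cons_of_mem _ h)) 0 (by simp)
          simp only [List.getElem_cons_zero] at this
          omega
    cases n with
    | zero => simpa using h0
    | succ n =>
      cases r with
      | nil => simp at hn
      | cons c' r =>
        have := ih ht.2.2.2 (fun h => hs (List.mem_cons_of_mem _ h)) n
          (by simpa using hn)
        rw [List.getElem_cons_succ, this, h0]
        omega

lemma IsTail.dist_head (hc : G.Connected) {w c : V} {r : List V} (ht : IsTail G w (c :: r))
    {s : V} (hs : s ∉ c :: r) : G.dist s c = G.dist s w + 1 := by
  exact ht.dist_getElem hc hs 0 (by simp)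

lemma IsTail.tail_unique {w c : V} {r r' : List V} (ht : IsTail G w (c :: r))
    (ht' : IsTail G w (c :: r')) : r = r' := by
  induction r generalizing w c r' with
  | nil =>
    cases r' with
    | nil => rfl
    | cons c' r' => exact absurd (ht.2 c' ht'.2.2.2.adj).symm ht'.2.1
  | cons c₁ r ih =>
    cases r' with
    | nil => exact absurd (ht'.2 c₁ ht.2.2.2.adj).symm ht.2.1
    | cons c₂ r' =>
      have : c₁ = c₂ := by
        rcases ht'.2.2.1 c₁ ht.2.2.2.adj with h | h
        · exact absurd h.symm ht.2.1
        · exact h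
      subst this
      rw [ih ht.2.2.2 ht'.2.2.2]

lemma IsTail.dist_head_le (hc : G.Connected) {w c : V} {r : List V} (ht : IsTail G w (c :: r))
    (n : ℕ) (hn : n < (c :: r).length) : G.dist c (c :: r)[n] ≤ n := by
  induction n generalizing w c r with
  | zero => simp
  | succ n ih =>
    cases r with
    | nil => simp at hn
    | cons c' r =>
      have hn' : n < (c' :: r).length := by simpa using hn
      have h1 := ih ht.2.2.2 hn'
      have h2 := dist_le_succ_of_adj hc ht.2.2.2.adj (c' :: r)[n]
      rw [List.getElem_cons_succ]
      omega

/-- Tails that meet coincide. -/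
lemma IsTail.eq_of_mem (hc : G.Connected) {w w' x : V} {t t' : List V} (ht : IsTail G w t)
    (ht' : IsTail G w' t') (hw : w ∉ t) (hw' : w' ∉ t') (hww' : w ∉ t') (hw'w : w' ∉ t)
    (hx : x ∈ t) (hx' : x ∈ t') : w = w' ∧ t = t' := by
  obtain ⟨n, hn, rfl⟩ := List.getElem_of_mem hx
  obtain ⟨m, hm, hnm⟩ := List.getElem_of_mem hx'
  have h1 := ht.dist_getElem hc hw n hn
  have h2 := ht.dist_getElem hc hw'w n hn
  have h3 := ht'.dist_getElem hc hww' m hm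
  have h4 := ht'.dist_getElem hc hw' m hm
  rw [hnm] at h3 h4
  rw [SimpleGraph.dist_self] at h1 h4
  have hd : G.dist w w' = 0 := by omega
  have := hc.dist_eq_zero_iff.1 hd
  subst this
  have : m = n := by omega
  subst this
  refine ⟨rfl, ?_⟩
  cases t with
  | nil => exact absurd rfl ht.ne_nil
  | cons c r =>
    cases t' with
    | nil => exact absurd rfl ht'.ne_nil
    | cons c' r' =>
      have hcc : c = c' := by
        by_cases hmem : c ∈ c' :: r'
        · obtain ⟨j, hj, hjc⟩ := List.getElem_of_mem hmem
          have h5 := ht'.dist_getElem hc hw' j hj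
          rw [hjc, SimpleGraph.dist_self, dist_eq_one_iff_adj.2 ht.adj] at h5
          have : j = 0 := by omega
          subst this
          simpa using hjc.symm
        · have h5 := ht'.dist_getElem hc hmem m hm
          have h6 := ht.dist_head_le hc m hn
          rw [hnm] at h5
          omega
      subst hcc
      rw [ht.tail_unique ht']

lemma degree_eq_one_iff_of_adj [Fintype V] [DecidableRel G.Adj] {c w : V} (h : G.Adj c w) :
    G.degree c = 1 ↔ ∀ z, G.Adj c z → z = w := by
  rw [← card_neighborFinset_eq_degree, Finset.card_eq_one]
  constructor
  · rintro ⟨a, ha⟩ z hz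
    have h1 : z ∈ G.neighborFinset c := by simpa using hz
    have h2 : w ∈ G.neighborFinset c := by simpa using h
    rw [ha, Finset.mem_singleton] at h1 h2
    rw [h1, h2]
  · intro hz
    refine ⟨w, ?_⟩
    ext z
    simp only [mem_neighborFinset, Finset.mem_singleton]
    exact ⟨hz z, fun hzw => hzw ▸ h⟩

lemma degree_eq_two_iff_of_adj [Fintype V] [DecidableRel G.Adj] {c w w' : V}
    (h : G.Adj c w) (h' : G.Adj c w') (hne : w ≠ w') :
    G.degree c = 2 ↔ ∀ z, G.Adj c z → z = w ∨ z = w' := by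
  classical
  rw [← card_neighborFinset_eq_degree]
  have hsub : {w, w'} ⊆ G.neighborFinset c := by
    intro z hz
    simp only [Finset.mem_insert, Finset.mem_singleton] at hz
    rcases hz with rfl | rfl <;> simpa
  constructor
  · intro hcard z hz
    have := Finset.eq_of_subset_of_card_le hsub (by rw [hcard, Finset.card_pair hne])
    have hz : z ∈ G.neighborFinset c := by simpa using hz
    rw [← this] at hz
    simpa using hz
  · intro hz
    have : G.neighborFinset c = {w, w'} := by
      refine Finset.Subset.antisymm (fun z hz' => ?_) hsub
      simpa using hz z (by simpa using hz')
    rw [this, Finset.card_pair hne]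

lemma three_le_degree [Fintype V] [DecidableRel G.Adj] {w a b c : V} (ha : G.Adj w a)
    (hb : G.Adj w b) (hc : G.Adj w c) (hab : a ≠ b) (hac : a ≠ c) (hbc : b ≠ c) :
    3 ≤ G.degree w := by
  classical
  rw [← card_neighborFinset_eq_degree, ← Finset.card_eq_three.2 ⟨a, b, c, hab, hac, hbc, rfl⟩]
  refine Finset.card_le_card fun z hz => ?_
  simp only [Finset.mem_insert, Finset.mem_singleton] at hz
  rcases hz with rfl | rfl | rfl <;> simpa

variable [Fintype V] [DecidableRel G.Adj]

lemma IsThreadAt.isTail {v : V} {t : List V} (ht : IsThreadAt G v t) : IsTail G v t := by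
  obtain ⟨hne, hnd, hv, -, hch, hhd, hlast, hdl⟩ := ht
  induction t generalizing v with
  | nil => exact absurd rfl hne
  | cons c r ih =>
    have hvc : G.Adj v c := hhd c (by simp)
    cases r with
    | nil => exact ⟨hvc, (degree_eq_one_iff_of_adj hvc.symm).1 (hlast c (by simp))⟩
    | cons c' r =>
      have hvc' : v ≠ c' := fun h => hv (by simp [h])
      have hcc' : G.Adj c c' := by
        have : List.IsChain G.Adj (c :: c' :: r) := hch
        rw [List.isChain_cons_cons] at this
        exact this.1
      refine ⟨hvc, hvc', ?_, ?_⟩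
      · exact (degree_eq_two_iff_of_adj hvc.symm hcc' hvc').1 (hdl c (by simp))
      · refine ih (by simp) hnd.of_cons (List.nodup_cons.1 hnd).1 hch.tail ?_ ?_ ?_
        · simpa using hcc'
        · simpa using hlast
        · intro x hx
          exact hdl x (by rw [List.dropLast_cons_cons]; exact List.mem_cons_of_mem _ hx)

lemma IsTail.isThreadAt {v : V} {t : List V} (ht : IsTail G v t) (hnd : (v :: t).Nodup)
    (hv : 3 ≤ G.degree v) : IsThreadAt G v t := by
  refine ⟨ht.ne_nil, hnd.of_cons, (List.nodup_cons.1 hnd).1, hv, ?_⟩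
  clear hv
  induction t generalizing v with
  | nil => exact absurd rfl ht.ne_nil
  | cons c r ih =>
    cases r with
    | nil =>
      exact ⟨List.isChain_singleton c, by simpa using ht.1,
        by simpa using (degree_eq_one_iff_of_adj ht.1.symm).2 ht.2, by simp⟩
    | cons c' r =>
      obtain ⟨hvc, hvc', hnb, htail⟩ := ht
      obtain ⟨h1, -, h3, h4⟩ := ih htail hnd.of_cons
      refine ⟨List.IsChain.cons_cons htail.adj h1, by simpa using hvc, by simpa using h3, ?_⟩
      intro x hx
      rw [List.dropLast_cons_cons, List.mem_cons] at hx
      rcases hx with rfl | hx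
      · exact (degree_eq_two_iff_of_adj hvc.symm htail.adj hvc').2 hnb
      · exact h4 x hx

lemma IsThreadAt.degree_le_two {v x : V} {t : List V} (ht : IsThreadAt G v t) (hx : x ∈ t) :
    G.degree x ≤ 2 := by
  obtain ⟨hne, -, -, -, -, -, hlast, hdl⟩ := ht
  rw [← List.dropLast_append_getLast hne, List.mem_append, List.mem_singleton] at hx
  rcases hx with hx | rfl
  · exact (hdl x hx).le
  · rw [hlast _ (List.getLast_mem_getLast? hne)]
    norm_num

lemma IsThreadAt.notMem {v v' : V} {t t' : List V} (ht : IsThreadAt G v t)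
    (ht' : IsThreadAt G v' t') : v ∉ t' := fun h => by
  have := ht'.degree_le_two h
  have := ht.2.2.2.1
  omega

/-- Distinct threads are disjoint. -/
lemma IsThreadAt.eq_of_mem (hc : G.Connected) {v v' x : V} {t t' : List V}
    (ht : IsThreadAt G v t) (ht' : IsThreadAt G v' t') (hx : x ∈ t) (hx' : x ∈ t') :
    v = v' ∧ t = t' :=
  ht.isTail.eq_of_mem hc ht'.isTail (ht.notMem ht) (ht'.notMem ht') (ht.notMem ht')
    (ht'.notMem ht) hx hx'

lemma finite_threads (v : V) : {t : List V | IsThreadAt G v t}.Finite := by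
  classical
  have : {t : List V | t.Nodup}.Finite :=
    Set.finite_coe_iff.1 (inferInstanceAs (Finite {t : List V // t.Nodup}))
  exact this.subset fun t ht => ht.2.1

end Threads

section CycleThreads

variable {V : Type*} {G : SimpleGraph V} {g : ℕ} {u : ℕ → V} {pos : V → ℕ}

namespace CycleCoords

lemma ne_cycle_of_mem_tail (h : CycleCoords G g u pos) {w : V} {t : List V}
    (ht : IsTail G w t) : ∀ x ∈ t, x ≠ u (pos x) := by
  induction t generalizing w with
  | nil => exact absurd rfl ht.ne_nil
  | cons c r ih =>
    have two : c = u (pos c) → ∃ a b, a ≠ b ∧ G.Adj c a ∧ G.Adj c b ∧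
        a = u (pos a) ∧ b = u (pos b) := by
      intro hc
      obtain ⟨j, k, hj, hk, hjk, -, -, haj, hak⟩ := h.exists_adj_cycle (h.pos_lt c)
      rw [← hc] at haj hak
      refine ⟨u j, u k, fun he => hjk ?_, haj, hak, ?_, ?_⟩
      · rw [← h.pos_cycle j hj, he, h.pos_cycle k hk]
      · rw [h.pos_cycle j hj]
      · rw [h.pos_cycle k hk]
    cases r with
    | nil =>
      intro x hx hc
      rw [List.mem_singleton] at hx
      subst hx
      obtain ⟨a, b, hab, ha, hb, -, -⟩ := two hc
      exact hab ((ht.2 a ha).trans (ht.2 b hb).symm)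
    | cons c' r =>
      intro x hx
      have hr := ih ht.2.2.2
      rcases List.mem_cons.1 hx with rfl | hx'
      · intro hc
        obtain ⟨a, b, hab, ha, hb, ha', hb'⟩ := two hc
        have hc' := hr c' List.mem_cons_self
        rcases ht.2.2.1 a ha with rfl | rfl
        · rcases ht.2.2.1 b hb with rfl | rfl
          · exact hab rfl
          · exact hc' hb'
        · exact hc' ha'
      · exact hr x hx'

lemma pos_of_mem_tail (h : CycleCoords G g u pos) {w : V} {t : List V}
    (ht : IsTail G w t) : ∀ x ∈ t, pos x = pos w := by
  induction t generalizing w with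
  | nil => exact absurd rfl ht.ne_nil
  | cons c r ih =>
    have hc : pos c = pos w :=
      (h.pos_eq_of_adj ht.adj (h.ne_cycle_of_mem_tail ht c List.mem_cons_self)).symm
    intro x hx
    rcases List.mem_cons.1 hx with rfl | hx
    · exact hc
    · cases r with
      | nil => simp at hx
      | cons c' r => rw [ih ht.2.2.2 x hx, hc]

variable [Fintype V] [DecidableRel G.Adj]

lemma three_le_degree_of_isChild (h : CycleCoords G g u pos) {w c c' : V}
    (hc : IsChild G u pos w c) (hc' : IsChild G u pos w c') (hne : c ≠ c') :
    3 ≤ G.degree w := by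
  obtain ⟨z, hz, hz'⟩ := h.exists_adj_not_isChild w
  exact three_le_degree hc.1 hc'.1 hz hne (fun he => hz' (he ▸ hc)) (fun he => hz' (he ▸ hc'))

lemma three_le_degree_cycle (h : CycleCoords G g u pos) {w c : V}
    (hc : IsChild G u pos w c) (hw : w = u (pos w)) : 3 ≤ G.degree w := by
  obtain ⟨j, k, hj, hk, hjk, hji, hki, haj, hak⟩ := h.exists_adj_cycle (h.pos_lt w)
  rw [← hw] at haj hak
  refine three_le_degree haj hak hc.1 (fun he => hjk ?_) (fun he => hji ?_) (fun he => hki ?_)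
  · rw [← h.pos_cycle j hj, he, h.pos_cycle k hk]
  · rw [hc.2.1, ← he, h.pos_cycle j hj]
  · rw [hc.2.1, ← he, h.pos_cycle k hk]

/-- A branch without vertices of a branch-resolving set is a thread. -/
lemma exists_tail_of_branch_free (h : CycleCoords G g u pos) {S : Set V}
    (hS : BranchResolving G S) {w c : V} (hc : IsChild G u pos w c)
    (hfree : ∀ s ∈ S, G.dist w s ≠ G.dist c s + 1) :
    ∃ r, IsTail G w (c :: r) ∧ (∀ x ∈ c :: r, G.dist w x = G.dist c x + 1) ∧
      (w :: c :: r).Nodup ∧ ∀ y, G.dist w y = G.dist c y + 1 → G.dist w y ≤ (c :: r).length := by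
  induction hN : {y | G.dist w y = G.dist c y + 1}.ncard using Nat.strong_induction_on
    generalizing w c with
  | _ N ih =>
  have hconn := h.connected
  have hcw : G.dist w c = 1 := dist_eq_one_iff_adj.2 hc.1
  have hccyc := h.ne_cycle_of_isChild hc
  have child : ∀ z, G.Adj c z → z ≠ w → IsChild G u pos c z := by
    intro z hz hzw
    rcases h.isChild_or hz (h.pos_eq_of_adj hz.symm hccyc).symm with h' | h'
    · exact h'
    · exact absurd (h.parent_unique h' hc) hzw
  have sub : ∀ z, IsChild G u pos c z → z ≠ w → ∀ y, G.dist c y = G.dist z y + 1 →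
      G.dist w y = G.dist c y + 1 := by
    intro z hz hzw y hy
    rcases dist_bridge_or hconn hc.1 (h.isBridge_of_isChild hc) y with h' | h'
    · exact h'
    · exact absurd (eq_of_dist_bridge hconn hz.1 (h.isBridge_of_isChild hz) hc.1.symm hy h') hzw
  have next : ∀ y, G.dist w y = G.dist c y + 1 → y ≠ c →
      ∃ z, G.Adj c z ∧ z ≠ w ∧ G.dist c y = G.dist z y + 1 := by
    intro y hy hyc
    obtain ⟨z, hz, hd⟩ := exists_adj_dist_eq hconn hyc.symm
    refine ⟨z, hz, ?_, hd⟩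
    rintro rfl
    omega
  have descend : ∀ z, G.Adj c z → z ≠ w → ∃ r, IsTail G c (z :: r) ∧
      (∀ x ∈ z :: r, G.dist c x = G.dist z x + 1) ∧ (c :: z :: r).Nodup ∧
      ∀ y, G.dist c y = G.dist z y + 1 → G.dist c y ≤ (z :: r).length := by
    intro z hz hzw
    have hcz := child z hz hzw
    refine ih _ ?_ hcz (fun s hs he => hfree s hs (sub z hcz hzw s he)) rfl
    rw [← hN]
    refine Set.ncard_lt_ncard ⟨fun y hy => sub z hcz hzw y hy, fun hss => ?_⟩ (Set.toFinite _)
    have : G.dist c c = G.dist z c + 1 :=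
      hss (show G.dist w c = G.dist c c + 1 by rw [SimpleGraph.dist_self, hcw])
    rw [SimpleGraph.dist_self] at this
    omega
  by_cases hleaf : ∀ z, G.Adj c z → z = w
  · refine ⟨[], ⟨hc.1, hleaf⟩, ?_, by simpa using hc.1.ne, ?_⟩
    · intro x hx
      rw [List.mem_singleton] at hx
      rw [hx, SimpleGraph.dist_self, hcw]
    · intro y hy
      by_cases hyc : y = c
      · rw [hyc, hcw]
        simp
      · obtain ⟨z, hz, hzw, -⟩ := next y hy hyc
        exact absurd (hleaf z hz) hzw
  · push Not at hleaf
    obtain ⟨z, hz, hzw⟩ := hleaf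
    have hcz := child z hz hzw
    obtain ⟨r, hr, hrb, hrn, hry⟩ := descend z hz hzw
    have honly : ∀ z', G.Adj c z' → z' = w ∨ z' = z := by
      intro z' hz'
      by_contra hne
      push Not at hne
      have hcz' := child z' hz' hne.1
      obtain ⟨r', hr', hrb', hrn', -⟩ := descend z' hz' hne.1
      have hdeg := h.three_le_degree_of_isChild hcz' hcz hne.2
      rcases hS c _ _ (hr.isThreadAt hrn hdeg) (hr'.isThreadAt hrn' hdeg)
        (fun he => hne.2 (List.cons.inj he).1.symm) with ⟨s, hs, hst⟩ | ⟨s, hs, hst⟩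
      · exact hfree s hs (sub z hcz hzw s (hrb s hst))
      · exact hfree s hs (sub z' hcz' hne.1 s (hrb' s hst))
    have hbr : ∀ x ∈ c :: z :: r, G.dist w x = G.dist c x + 1 := by
      intro x hx
      rcases List.mem_cons.1 hx with rfl | hx
      · rw [SimpleGraph.dist_self, hcw]
      · exact sub z hcz hzw x (hrb x hx)
    refine ⟨z :: r, ⟨hc.1, hzw.symm, honly, hr⟩, hbr, ?_, ?_⟩
    · rw [List.nodup_cons]
      refine ⟨fun hw => ?_, hrn⟩
      have := hbr w hw
      rw [SimpleGraph.dist_self] at this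
      omega
    · intro y hy
      by_cases hyc : y = c
      · rw [hyc, hcw]
        simp
      · obtain ⟨z', hz', hzw', hd⟩ := next y hy hyc
        rcases honly z' hz' with rfl | rfl
        · exact absurd rfl hzw'
        · have := hry y hd
          rw [List.length_cons]
          omega

/-- Two children of a vertex cannot both start branches that avoid a branch-resolving set. -/
lemma exists_mem_branch (h : CycleCoords G g u pos) {S : Set V} (hS : BranchResolving G S)
    {w c c' : V} (hc : IsChild G u pos w c) (hc' : IsChild G u pos w c') (hne : c ≠ c') :
    ∃ s ∈ S, G.dist w s = G.dist c s + 1 ∨ G.dist w s = G.dist c' s + 1 := by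
  by_contra hcon
  push Not at hcon
  obtain ⟨r, hr, hrb, hrn, -⟩ := h.exists_tail_of_branch_free hS hc fun s hs => (hcon s hs).1
  obtain ⟨r', hr', hrb', hrn', -⟩ := h.exists_tail_of_branch_free hS hc' fun s hs => (hcon s hs).2
  have hdeg := h.three_le_degree_of_isChild hc hc' hne
  rcases hS w _ _ (hr.isThreadAt hrn hdeg) (hr'.isThreadAt hrn' hdeg)
    (fun he => hne (List.cons.inj he).1) with ⟨s, hs, hst⟩ | ⟨s, hs, hst⟩
  · exact (hcon s hs).1 (hrb s hst)
  · exact (hcon s hs).2 (hrb' s hst)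

/-- The thread through `y` at a cycle vertex, when its branch avoids a branch-resolving set. -/
lemma exists_thread_of_branch_free (h : CycleCoords G g u pos) {S : Set V}
    (hS : BranchResolving G S) {y : V} (hy : y ≠ u (pos y))
    (hfree : ∀ s ∈ S, pos s = pos y → G.dist s y = height G u pos s + height G u pos y) :
    ∃ t, IsThreadAt G (u (pos y)) t ∧ SFree S t ∧ height G u pos y ≤ t.length := by
  have hp := h.pos_cycle _ (h.pos_lt y)
  obtain ⟨c, hadj, hd⟩ := exists_adj_dist_eq h.connected hy.symm
  have hdy : G.dist (u (pos y)) y = height G u pos y := rfl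
  have hcc : IsChild G u pos (u (pos y)) c := by
    have hcpos : pos (u (pos y)) = pos c := by
      by_contra hne
      obtain ⟨-, hc, -⟩ := h.eq_of_adj _ _ hadj hne
      have := h.dist_cycle_vertex (h.pos_lt c) y
      rw [← hc, dist_comm] at this
      omega
    refine (h.isChild_or hadj hcpos).resolve_right fun hc => ?_
    have := hc.2.2
    rw [h.height_cycle (h.pos_lt y)] at this
    omega
  obtain ⟨r, hr, hrb, hrn, hry⟩ := h.exists_tail_of_branch_free hS hcc (fun s hs he => by
    obtain ⟨h1, h2⟩ := h.branch_height hcc he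
    rw [hp] at h1
    have h3 := hfree s hs h1
    have h4 := h.connected.dist_triangle (u := s) (v := c) (w := y)
    rw [dist_comm (u := s) (v := c)] at h4
    rw [h.height_cycle (h.pos_lt y)] at h2
    omega)
  refine ⟨c :: r, hr.isThreadAt hrn (h.three_le_degree_cycle hcc (by rw [hp])), ?_, hry y hd⟩
  intro x hx hxS
  obtain ⟨h1, h2⟩ := h.branch_height hcc (hrb x hx)
  rw [hp] at h1
  have h3 := hfree x hxS h1
  have h4 := h.connected.dist_triangle (u := x) (v := c) (w := y)
  rw [dist_comm (u := x) (v := c)] at h4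
  rw [h.height_cycle (h.pos_lt y)] at h2
  omega

end CycleCoords
end CycleThreads

section Core

variable {V : Type*} {G : SimpleGraph V} {g : ℕ} {u : ℕ → V} {pos : V → ℕ}

namespace CycleCoords

lemma isChild_of_dist (h : CycleCoords G g u pos) {w c x : V} {p : ℕ}
    (hwx : G.dist (u p) x = G.dist (u p) w + G.dist w x) (hx : pos x = p) (hw : pos w = p)
    (hadj : G.Adj w c) (hd : G.dist w x = G.dist c x + 1) : IsChild G u pos w c := by
  have hcpos : pos w = pos c := by
    by_contra hne
    obtain ⟨h1, h2, h3⟩ := h.eq_of_adj _ _ hadj hne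
    have h4 := h.dist_cycle_vertex (h.pos_lt c) x
    rw [← h2, dist_comm, hx, ← hw, h3] at h4
    have h5 : G.dist w x = height G u pos x := by rw [height, hx, ← hw, ← h1]
    omega
  refine (h.isChild_or hadj hcpos).resolve_right fun hc => ?_
  have h1 := hc.2.2
  rw [height, height, ← hcpos, hw] at h1
  have h2 := h.connected.dist_triangle (u := u p) (v := c) (w := x)
  omega

variable [Fintype V] [DecidableRel G.Adj]

/-- Vertices of the same tree at the same height are distinguished by a branch-resolving set. -/
lemma exists_dist_ne_of_height_eq (h : CycleCoords G g u pos) {S : Set V}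
    (hS : BranchResolving G S) {x y : V} (hne : x ≠ y) (hpos : pos x = pos y)
    (hh : height G u pos x = height G u pos y) : ∃ s ∈ S, G.dist s x ≠ G.dist s y := by
  have key : ∀ (n : ℕ) (w : V), pos w = pos x → G.dist w x = n → G.dist w y = n →
      G.dist (u (pos x)) x = G.dist (u (pos x)) w + n →
      G.dist (u (pos x)) y = G.dist (u (pos x)) w + n → ∃ s ∈ S, G.dist s x ≠ G.dist s y := by
    intro n
    induction n with
    | zero =>
      intro w _ hx hy
      exact absurd ((h.connected.dist_eq_zero_iff.1 hx).symm.trans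
        (h.connected.dist_eq_zero_iff.1 hy)) hne
    | succ n ih =>
      intro w hw hx hy hxw hyw
      have hwx : w ≠ x := by
        rintro rfl
        rw [SimpleGraph.dist_self] at hx
        omega
      have hwy : w ≠ y := by
        rintro rfl
        rw [SimpleGraph.dist_self] at hy
        omega
      obtain ⟨c, hc, hcx⟩ := exists_adj_dist_eq h.connected hwx
      obtain ⟨c', hc', hcy⟩ := exists_adj_dist_eq h.connected hwy
      have hch := h.isChild_of_dist (by omega) rfl hw hc hcx
      have hch' := h.isChild_of_dist (by omega) hpos.symm hw hc' hcy
      by_cases hcc : c = c'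
      · subst hcc
        have h1 := hch.2.2
        rw [height, height, ← hch.2.1, hw] at h1
        exact ih c (hch.2.1.symm.trans hw) (by omega) (by omega) (by omega) (by omega)
      · obtain ⟨s, hs, hsd | hsd⟩ := h.exists_mem_branch hS hch hch' hcc
        · refine ⟨s, hs, fun he => ?_⟩
          have hbr := h.isBridge_of_isChild hch'
          have hsc' : G.dist c' s = G.dist w s + 1 :=
            (dist_bridge_or h.connected hc' hbr s).resolve_left fun h' =>
              hcc (eq_of_dist_bridge h.connected hc (h.isBridge_of_isChild hch) hc' hsd h')
          have h1 := dist_across_bridge h.connected hbr hsc' hcy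
          have h2 := h.connected.dist_triangle (u := s) (v := c) (w := x)
          rw [dist_comm] at hsd
          rw [dist_comm (u := c)] at hsd
          omega
        · refine ⟨s, hs, fun he => ?_⟩
          have hbr := h.isBridge_of_isChild hch
          have hsc : G.dist c s = G.dist w s + 1 :=
            (dist_bridge_or h.connected hc hbr s).resolve_left fun h' =>
              hcc (eq_of_dist_bridge h.connected hc hbr hc' h' hsd)
          have h1 := dist_across_bridge h.connected hbr hsc hcx
          have h2 := h.connected.dist_triangle (u := s) (v := c') (w := y)
          rw [dist_comm] at hsd
          rw [dist_comm (u := c')] at hsd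
          omega
  refine key (height G u pos x) (u (pos x)) (h.pos_cycle _ (h.pos_lt x)) rfl ?_ ?_ ?_
  · rw [hh, height, hpos]
  · rw [SimpleGraph.dist_self, zero_add, height]
  · rw [SimpleGraph.dist_self, zero_add, hh, height, hpos]

/-- What remains when a branch-resolving set with two active positions fails to distinguish a
pair of vertices. -/
lemma undistinguished_cases (h : CycleCoords G g u pos) {S : Set V}
    (hS : BranchResolving G S) {a₁ a₂ : V} (ha₁ : a₁ ∈ S) (ha₂ : a₂ ∈ S)
    (ha : pos a₁ ≠ pos a₂) {x y : V} (hne : x ≠ y) (hxy : ∀ s ∈ S, G.dist s x = G.dist s y) :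
    (∃ p q, p < g ∧ q < g ∧ p ≠ q ∧ (∃ t, IsThreadAt G (u p) t ∧ SFree S t) ∧
      ∀ s ∈ S, cycDist g (pos s) q = cycDist g (pos s) p + cycDist g p q) ∨
    (∃ p q δ, p < g ∧ q < g ∧ p ≠ q ∧ δ < cycDist g p q ∧
      (∀ s ∈ S, cycDist g (pos s) p = cycDist g (pos s) q + δ) ∧
      (0 < δ → ∃ t, IsThreadAt G (u q) t ∧ SFree S t ∧ δ ≤ t.length)) := by
  have hcomm : ∀ i j, cycDist g i j = cycDist g j i := fun i j => by
    simp only [cycDist, add_comm]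
  have hself : ∀ i, cycDist g i i = 0 := fun i => by simp [cycDist]
  have hsep : ∀ x, ∃ a ∈ S, pos a ≠ pos x := fun x => by
    by_cases h1 : pos a₁ = pos x
    · exact ⟨a₂, ha₂, fun h2 => ha (h1.trans h2.symm)⟩
    · exact ⟨a₁, ha₁, h1⟩
  by_cases hpos : pos x = pos y
  · exfalso
    obtain ⟨a, haS, hap⟩ := hsep x
    have h1 := hxy a haS
    rw [h.dist_of_pos_ne hap, h.dist_of_pos_ne (hpos ▸ hap), hpos] at h1
    obtain ⟨s, hs, hsn⟩ := h.exists_dist_ne_of_height_eq hS hne hpos (by omega)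
    exact hsn (hxy s hs)
  -- the common part of the two symmetric cases
  have main : ∀ x y : V, pos x ≠ pos y → (∀ s ∈ S, G.dist s x = G.dist s y) →
      height G u pos x = height G u pos y + cycDist g (pos x) (pos y) →
      (∀ s ∈ S, pos s ≠ pos y) →
      (∃ p q, p < g ∧ q < g ∧ p ≠ q ∧ (∃ t, IsThreadAt G (u p) t ∧ SFree S t) ∧
        ∀ s ∈ S, cycDist g (pos s) q = cycDist g (pos s) p + cycDist g p q) := by
    intro x y hpos hxy hh hy
    have hx' : x ≠ u (pos x) := by
      intro hx
      have h1 := h.height_eq_zero.2 hx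
      have h2 : cycDist g (pos x) (pos y) ≠ 0 := by
        have := h.pos_lt x
        have := h.pos_lt y
        simp only [cycDist]
        omega
      omega
    obtain ⟨t, ht, hfree, -⟩ := h.exists_thread_of_branch_free hS hx' (fun s hs hsx => by
      rw [hxy s hs, h.dist_of_pos_ne (hy s hs), hh, hsx]
      omega)
    refine ⟨pos x, pos y, h.pos_lt x, h.pos_lt y, hpos, ⟨t, ht, hfree⟩, fun s hs => ?_⟩
    by_cases hsx : pos s = pos x
    · rw [hsx, hself, zero_add]
    · have := hxy s hs
      rw [h.dist_of_pos_ne hsx, h.dist_of_pos_ne (hy s hs)] at this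
      omega
  have cyc_pos : ∀ p q, p < g → q < g → p ≠ q → 0 < cycDist g p q := fun p q hp hq hpq => by
    simp only [cycDist]
    omega
  have cyc_triangle : ∀ a p q, a < g → p < g → q < g →
      cycDist g a p ≤ cycDist g a q + cycDist g p q := fun a p q _ _ _ => by
    simp only [cycDist]
    omega
  have lower : ∀ x y : V, pos x ≠ pos y → (∀ s ∈ S, G.dist s x = G.dist s y) →
      ∀ s ∈ S, pos s = pos x →
      height G u pos y + cycDist g (pos x) (pos y) ≤ height G u pos x := by
    intro x y hpos hxy s hs hsx
    have h1 := hxy s hs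
    have h2 := h.dist_le_height_add hsx
    rw [h.dist_of_pos_ne (y := y) (hsx ▸ hpos), hsx] at h1
    omega
  have active : ∀ x y : V, pos x ≠ pos y → (∀ s ∈ S, G.dist s x = G.dist s y) →
      ∀ s ∈ S, pos s = pos x →
      height G u pos x = height G u pos y + cycDist g (pos x) (pos y) ∧
        ∀ s ∈ S, pos s ≠ pos y := by
    intro x y hpos hxy s hs hsx
    have h1 := lower x y hpos hxy s hs hsx
    have h2 := cyc_pos _ _ (h.pos_lt x) (h.pos_lt y) hpos
    have hy : ∀ s ∈ S, pos s ≠ pos y := fun s hs hsy => by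
      have := lower y x hpos.symm (fun s hs => (hxy s hs).symm) s hs hsy
      omega
    obtain ⟨a, haS, hap⟩ := hsep x
    have h3 := hxy a haS
    rw [h.dist_of_pos_ne hap, h.dist_of_pos_ne (hy a haS)] at h3
    have h4 := cyc_triangle _ _ _ (h.pos_lt a) (h.pos_lt y) (h.pos_lt x)
    rw [hcomm (pos y)] at h4
    exact ⟨by omega, hy⟩
  by_cases hx : ∃ s ∈ S, pos s = pos x
  · obtain ⟨s, hs, hsx⟩ := hx
    obtain ⟨h1, h2⟩ := active x y hpos hxy s hs hsx
    exact Or.inl (main x y hpos hxy h1 h2)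
  by_cases hy : ∃ s ∈ S, pos s = pos y
  · obtain ⟨s, hs, hsy⟩ := hy
    have hxy' : ∀ s ∈ S, G.dist s y = G.dist s x := fun s hs => (hxy s hs).symm
    obtain ⟨h1, h2⟩ := active y x (Ne.symm hpos) hxy' s hs hsy
    exact Or.inl (main y x (Ne.symm hpos) hxy' h1 h2)
  push Not at hx hy
  wlog hle : height G u pos x ≤ height G u pos y generalizing x y
  · exact this hne.symm (fun s hs => (hxy s hs).symm) (Ne.symm hpos) hy hx (by omega)
  have hdist : ∀ s ∈ S, cycDist g (pos s) (pos x) + height G u pos x =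
      cycDist g (pos s) (pos y) + height G u pos y := by
    intro s hs
    have := hxy s hs
    rw [h.dist_of_pos_ne (hx s hs), h.dist_of_pos_ne (hy s hs)] at this
    omega
  have hub : height G u pos y ≤ height G u pos x + cycDist g (pos x) (pos y) := by
    have h1 := hdist a₁ ha₁
    have h2 := cyc_triangle _ _ _ (h.pos_lt a₁) (h.pos_lt x) (h.pos_lt y)
    omega
  rcases hub.eq_or_lt with heq | hlt
  · exact Or.inl (main y x (Ne.symm hpos) (fun s hs => (hxy s hs).symm) (by rw [hcomm, heq]) hx)
  · refine Or.inr ⟨pos x, pos y, height G u pos y - height G u pos x, h.pos_lt x, h.pos_lt y, hpos,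
      by omega, fun s hs => ?_, fun hδ => ?_⟩
    · have := hdist s hs
      omega
    · obtain ⟨t, ht, hfree, hlen⟩ := h.exists_thread_of_branch_free hS (y := y)
        (fun he => by
          have := h.height_eq_zero.2 he
          omega) (fun s hs he => absurd he (hy s hs))
      exact ⟨t, ht, hfree, by omega⟩

end CycleCoords
end Core

section Labels

variable {V : Type*} {G : SimpleGraph V} {g : ℕ} {vc vc' : ZMod g → V} {pos : V → ℕ} {S : Set V}

/-- Coordinates attached to a labelling of the cycle: `pos x` is the index of the tree
containing `x`. -/
structure LabelCoords (G : SimpleGraph V) (g : ℕ) (vc : ZMod g → V) (pos : V → ℕ) : Prop where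
  label : IsCycleLabelling G g vc
  coords : CycleCoords G g (fun n : ℕ => vc n) pos
  inTree_iff : ∀ (n : ℕ) (x : V), n < g → (inTree G g vc n x ↔ pos x = n)

lemma exists_labelCoords (hG : IsUnicyclic G) (hg : 3 ≤ g) (hvc : IsCycleLabelling G g vc) :
    ∃ pos, LabelCoords G g vc pos := by
  obtain ⟨pos, h1, h2⟩ := exists_pos hG hg hvc
  exact ⟨pos, hvc, h1, h2⟩

lemma natCast_inj_of_lt {i j : ℕ} (hi : i < g) (hj : j < g) (h : (i : ZMod g) = j) : i = j := by
  rw [ZMod.natCast_eq_natCast_iff'] at h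
  rwa [Nat.mod_eq_of_lt hi, Nat.mod_eq_of_lt hj] at h

lemma exists_natCast_eq (hg : 3 ≤ g) (i : ZMod g) : ∃ n : ℕ, n < g ∧ (n : ZMod g) = i := by
  have : NeZero g := ⟨by omega⟩
  exact ⟨i.val, i.val_lt, ZMod.natCast_zmod_val i⟩

namespace LabelCoords

lemma sActive_iff (h : LabelCoords G g vc pos) {n : ℕ} (hn : n < g) :
    SActive G g vc S n ↔ ∃ s ∈ S, pos s = n := by
  simp only [SActive, h.inTree_iff n _ hn]

lemma aS_eq (h : LabelCoords G g vc pos) : aS G g vc S = (pos '' S).ncard := by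
  have : {i : ZMod g | SActive G g vc S i} = (fun n : ℕ => (n : ZMod g)) '' (pos '' S) := by
    ext i
    obtain ⟨n, hn, rfl⟩ := exists_natCast_eq h.coords.three_le i
    rw [Set.mem_ofPred_eq, h.sActive_iff hn]
    constructor
    · rintro ⟨s, hs, hsn⟩
      exact ⟨n, ⟨s, hs, hsn⟩, rfl⟩
    · rintro ⟨m, ⟨s, hs, hsm⟩, hmn⟩
      refine ⟨s, hs, ?_⟩
      rw [hsm]
      exact natCast_inj_of_lt (hsm ▸ h.coords.pos_lt s) hn hmn
  rw [aS, this]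
  refine Set.InjOn.ncard_image ?_
  rintro _ ⟨s, -, rfl⟩ _ ⟨s', -, rfl⟩ he
  exact natCast_inj_of_lt (h.coords.pos_lt s) (h.coords.pos_lt s') he

lemma finite_image (h : LabelCoords G g vc pos) : (pos '' S).Finite := by
  refine (Set.finite_lt_nat g).subset ?_
  rintro _ ⟨s, -, rfl⟩
  exact h.coords.pos_lt s

lemma biactive_iff (h : LabelCoords G g vc pos) :
    Biactive G g vc S ↔ ∃ s₁ ∈ S, ∃ s₂ ∈ S, pos s₁ ≠ pos s₂ := by
  rw [Biactive, h.aS_eq]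
  change 1 < _ ↔ _
  rw [Set.one_lt_ncard h.finite_image]
  simp

lemma kOf_eq (h : LabelCoords G g vc pos) : kOf G g vc S = sSup (pos '' S) := by
  rw [kOf]
  congr 1
  ext n
  constructor
  · rintro ⟨hn, ha⟩
    exact (h.sActive_iff hn).1 ha
  · rintro ⟨s, hs, rfl⟩
    exact ⟨h.coords.pos_lt s, (h.sActive_iff (h.coords.pos_lt s)).2 ⟨s, hs, rfl⟩⟩

lemma le_kOf (h : LabelCoords G g vc pos) {s : V} (hs : s ∈ S) : pos s ≤ kOf G g vc S := by
  rw [h.kOf_eq]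
  exact le_csSup h.finite_image.bddAbove ⟨s, hs, rfl⟩

lemma exists_pos_eq_kOf (h : LabelCoords G g vc pos) {s : V} (hs : s ∈ S) :
    ∃ s ∈ S, pos s = kOf G g vc S := by
  rw [h.kOf_eq]
  have hne : (pos '' S).Nonempty := ⟨pos s, s, hs, rfl⟩
  exact Nat.sSup_mem hne h.finite_image.bddAbove

lemma pos_eq_iff (h : LabelCoords G g vc pos) (x y : V) :
    pos x = pos y ↔ (offCycle G g vc).Reachable x y := by
  have hx := (h.inTree_iff _ x (h.coords.pos_lt x)).2 rfl
  have hy := (h.inTree_iff _ y (h.coords.pos_lt y)).2 rfl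
  constructor
  · intro he
    rw [← he] at hy
    exact hx.symm.trans hy
  · intro hr
    exact ((h.inTree_iff _ y (h.coords.pos_lt x)).1 (hx.trans hr)).symm

end LabelCoords

lemma biactive_congr (hG : IsUnicyclic G) (hg : 3 ≤ g) (hvc : IsCycleLabelling G g vc)
    (hvc' : IsCycleLabelling G g vc') : Biactive G g vc S ↔ Biactive G g vc' S := by
  obtain ⟨pos, h⟩ := exists_labelCoords hG hg hvc
  obtain ⟨pos', h'⟩ := exists_labelCoords hG hg hvc'
  rw [h.biactive_iff, h'.biactive_iff]
  simp only [Ne, h.pos_eq_iff, h'.pos_eq_iff, offCycle_eq hG hg hvc hvc']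

/-- The labelling obtained by starting at `v_c`. -/
def rotate (vc : ZMod g → V) (c : ZMod g) : ZMod g → V := fun i => vc (i + c)

lemma isCycleLabelling_rotate (hvc : IsCycleLabelling G g vc) (c : ZMod g) :
    IsCycleLabelling G g (rotate vc c) := by
  refine ⟨fun i j hij => add_right_cancel (hvc.1 hij), fun i => ?_⟩
  rw [rotate, rotate, add_right_comm]
  exact hvc.2 _

lemma range_rotate (vc : ZMod g → V) (c : ZMod g) : Set.range (rotate vc c) = Set.range vc := by
  ext x
  constructor
  · rintro ⟨i, rfl⟩
    exact ⟨i + c, rfl⟩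
  · rintro ⟨i, rfl⟩
    exact ⟨i - c, by rw [rotate, sub_add_cancel]⟩

lemma sActive_rotate (hG : IsUnicyclic G) (hg : 3 ≤ g) (hvc : IsCycleLabelling G g vc)
    (c i : ZMod g) : SActive G g (rotate vc c) S i ↔ SActive G g vc S (i + c) := by
  simp only [SActive, inTree, offCycle_eq hG hg (isCycleLabelling_rotate hvc c) hvc]
  rfl

lemma kOf_rotate_le (hG : IsUnicyclic G) (h : LabelCoords G g vc pos) {c m : ℕ} (hc : c < g)
    (hm : ∀ s ∈ S, c ≤ pos s ∧ pos s ≤ c + m ∨ pos s + g ≤ c + m) :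
    kOf G g (rotate vc c) S ≤ m := by
  refine csSup_le' ?_
  rintro n ⟨hn, ha⟩
  rw [sActive_rotate hG h.coords.three_le h.label] at ha
  by_cases hlt : n + c < g
  · obtain ⟨s, hs, hsn⟩ := (h.sActive_iff hlt).1 (by exact_mod_cast ha)
    rcases hm s hs with h' | h' <;> omega
  · have hcast : (n + c : ZMod g) = ((n + c - g : ℕ) : ZMod g) := by
      rw [Nat.cast_sub (by omega)]
      simp
    rw [hcast] at ha
    obtain ⟨s, hs, hsn⟩ := (h.sActive_iff (by omega)).1 ha
    rcases hm s hs with h' | h' <;> omega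

/-- In a canonical labelling, `k` is at most the length of any arc containing all active
vertices. -/
lemma kOf_le_of_canonical (hG : IsUnicyclic G) (h : LabelCoords G g vc pos)
    (hcan : Canonical G g vc S) {c m : ℕ} (hc : c < g)
    (hm : ∀ s ∈ S, c ≤ pos s ∧ pos s ≤ c + m ∨ pos s + g ≤ c + m) : kOf G g vc S ≤ m := by
  obtain ⟨-, h0, hmin⟩ := hcan
  obtain ⟨s₀, hs₀, -⟩ := h0
  have hne : S.Nonempty := ⟨s₀, hs₀⟩
  obtain ⟨s, hs, hsmin⟩ : ∃ s ∈ S, ∀ s' ∈ S, (if c ≤ pos s then pos s - c else pos s + g - c) ≤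
      (if c ≤ pos s' then pos s' - c else pos s' + g - c) := by
    have := WellFounded.has_min (InvImage.wf
      (fun x : V => if c ≤ pos x then pos x - c else pos x + g - c) Nat.lt_wfRel.wf) S hne
    obtain ⟨s, hs, hsm⟩ := this
    exact ⟨s, hs, fun s' hs' => not_lt.1 (hsm s' hs')⟩
  have hps := h.coords.pos_lt s
  refine (hmin (rotate vc (pos s : ℕ)) (isCycleLabelling_rotate h.label _) (range_rotate _ _)
    ?_).trans (kOf_rotate_le hG h hps fun s' hs' => ?_)
  · rw [sActive_rotate hG h.coords.three_le h.label, zero_add]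
    exact (h.sActive_iff hps).2 ⟨s, hs, rfl⟩
  · have h1 := hsmin s' hs'
    have h2 := hm s' hs'
    have h3 := hm s hs
    have h4 := h.coords.pos_lt s'
    split_ifs at h1 <;> omega

lemma exists_canonical (hG : IsUnicyclic G) (hg : 3 ≤ g) (hvc : IsCycleLabelling G g vc)
    (hS : S.Nonempty) : ∃ vc' : ZMod g → V, IsCycleLabelling G g vc' ∧
      Set.range vc' = Set.range vc ∧ Canonical G g vc' S := by
  obtain ⟨pos, h⟩ := exists_labelCoords hG hg hvc
  obtain ⟨s, hs⟩ := hS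
  let P : Set (ZMod g → V) := {w | IsCycleLabelling G g w ∧ Set.range w = Set.range vc ∧
    SActive G g w S 0}
  have hP : P.Nonempty := by
    refine ⟨rotate vc (pos s : ℕ), isCycleLabelling_rotate hvc _, range_rotate _ _, ?_⟩
    rw [sActive_rotate hG hg hvc, zero_add]
    exact (h.sActive_iff (h.coords.pos_lt s)).2 ⟨s, hs, rfl⟩
  obtain ⟨w, ⟨hw1, hw2, hw3⟩, hmin⟩ := WellFounded.has_min
    (InvImage.wf (fun w => kOf G g w S) Nat.lt_wfRel.wf) P hP
  exact ⟨w, hw1, hw2, hw1, hw3, fun w' h1 h2 h3 => not_lt.1 (hmin w' ⟨h1, h2.trans hw2, h3⟩)⟩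

/-- The set of active positions with respect to a canonical labelling. -/
lemma canonical_spec (h : LabelCoords G g vc pos)
    (hcan : Canonical G g vc S) (hbi : Biactive G g vc S) :
    0 < kOf G g vc S ∧ (∃ s ∈ S, pos s = 0) ∧ (∃ s ∈ S, pos s = kOf G g vc S) ∧
      (∀ s ∈ S, pos s ≤ kOf G g vc S) ∧ kOf G g vc S < g ∧
      (aS G g vc S = 2 ↔ ∀ s ∈ S, pos s = 0 ∨ pos s = kOf G g vc S) := by
  have hg := h.coords.three_le
  obtain ⟨s₀, hs₀, hp₀⟩ := (h.sActive_iff (n := 0) (by omega)).1 (by exact_mod_cast hcan.2.1)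
  obtain ⟨s₁, hs₁, hp₁⟩ := h.exists_pos_eq_kOf hs₀
  have hle : ∀ s ∈ S, pos s ≤ kOf G g vc S := fun s hs => h.le_kOf hs
  obtain ⟨a, ha, b, hb, hab⟩ := h.biactive_iff.1 hbi
  have h1 := hle a ha
  have h2 := hle b hb
  have hk : 0 < kOf G g vc S := by omega
  refine ⟨hk, ⟨s₀, hs₀, hp₀⟩, ⟨s₁, hs₁, hp₁⟩, hle, hp₁ ▸ h.coords.pos_lt s₁, ?_⟩
  have hsub : {0, kOf G g vc S} ⊆ pos '' S := by
    rintro _ (rfl | rfl)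
    · exact ⟨s₀, hs₀, hp₀⟩
    · exact ⟨s₁, hs₁, hp₁⟩
  have hpair := Set.ncard_pair (a := 0) (b := kOf G g vc S) hk.ne
  rw [h.aS_eq]
  constructor
  · intro hc s hs
    have := Set.eq_of_subset_of_ncard_le hsub (by rw [hc, hpair]) h.finite_image
    have hmem : pos s ∈ pos '' S := ⟨s, hs, rfl⟩
    rw [← this] at hmem
    exact hmem
  · intro hs
    have : pos '' S = {0, kOf G g vc S} := by
      refine Set.Subset.antisymm ?_ hsub
      rintro _ ⟨s, hsS, rfl⟩
      exact hs s hsS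
    rw [this, hpair]

end Labels

section Configurations

lemma cycDist_eq_add_imp {g a p q δ : ℕ} (ha : a < g) (hp : p < g) (hq : q < g) (hpq : p < q)
    (hδ : δ < cycDist g p q) (h : cycDist g a p = cycDist g a q + δ) :
    2 * a = p + q + δ ∨ 2 * a + δ = p + q + g ∨ 2 * a + g + δ = p + q := by
  simp only [cycDist] at *
  omega

lemma cycDist_eq_add_imp' {g a p q δ : ℕ} (ha : a < g) (hp : p < g) (hq : q < g) (hpq : q < p)
    (hδ : δ < cycDist g p q) (h : cycDist g a p = cycDist g a q + δ) :
    2 * a + δ = p + q ∨ 2 * a = p + q + g + δ ∨ 2 * a + g = p + q + δ := by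
  simp only [cycDist] at *
  omega

lemma cycDist_of_le {g i j : ℕ} (h : i ≤ j) : cycDist g i j = min (j - i) (g - (j - i)) := by
  rw [cycDist, Nat.sub_eq_zero_of_le h, zero_add]

lemma cycDist_comm (g i j : ℕ) : cycDist g i j = cycDist g j i := by
  rw [cycDist, cycDist, add_comm]

/-- A geodesic continuing from `p` to `q` comes from the other side of `p`. -/
lemma cycDist_geodesic {g a p q : ℕ} (ha : a < g) (hp : p < g) (hq : q < g) (hpq : p ≠ q)
    (h : cycDist g a q = cycDist g a p + cycDist g p q) :
    (p < q ∧ 2 * (q - p) ≤ g ∨ q < p ∧ g ≤ 2 * (p - q)) ∧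
      (a ≤ p ∧ p ≤ a + (g / 2 - 1) ∨ p + g ≤ a + (g / 2 - 1)) ∨
    (p < q ∧ g < 2 * (q - p) ∨ q < p ∧ 2 * (p - q) < g) ∧
      (p ≤ a ∧ a ≤ p + (g / 2 - 1) ∨ a + g ≤ p + (g / 2 - 1)) := by
  rcases Nat.lt_or_gt_of_ne hpq with hlt | hlt
  · rw [cycDist_of_le hlt.le] at h
    rcases le_total a p with hap | hap
    · rw [cycDist_of_le hap, cycDist_of_le (hap.trans hlt.le)] at h
      omega
    · rw [cycDist_comm g a p, cycDist_of_le hap] at h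
      rcases le_total a q with haq | haq
      · rw [cycDist_of_le haq] at h
        omega
      · rw [cycDist_comm, cycDist_of_le haq] at h
        omega
  · rw [cycDist_comm g p q, cycDist_of_le hlt.le] at h
    rcases le_total p a with hap | hap
    · rw [cycDist_comm g a p, cycDist_comm g a q, cycDist_of_le hap,
        cycDist_of_le (hlt.le.trans hap)] at h
      omega
    · rw [cycDist_of_le hap] at h
      rcases le_total a q with haq | haq
      · rw [cycDist_of_le haq] at h
        omega
      · rw [cycDist_comm, cycDist_of_le haq] at h
        omega

variable {V : Type*} {G : SimpleGraph V} {g : ℕ} {vc : ZMod g → V} {pos : V → ℕ} {S : Set V}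
  [Fintype V] [DecidableRel G.Adj]

lemma configB_of_geodesic (hG : IsUnicyclic G) (h : LabelCoords G g vc pos)
    (hcan : Canonical G g vc S) (hbi : Biactive G g vc S) {p q : ℕ} (hp : p < g) (hq : q < g)
    (hpq : p ≠ q) (ht : ∃ t, IsThreadAt G (vc p) t ∧ SFree S t)
    (hs : ∀ s ∈ S, cycDist g (pos s) q = cycDist g (pos s) p + cycDist g p q) :
    ConfigB G g vc S := by
  obtain ⟨hk, ⟨s₀, hs₀, hp₀⟩, ⟨s₁, hs₁, hp₁⟩, hle, hkg, -⟩ := canonical_spec h hcan hbi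
  have hgeo : ∀ s ∈ S, _ := fun s hsS =>
    cycDist_geodesic (h.coords.pos_lt s) hp hq hpq (hs s hsS)
  have hkle : kOf G g vc S ≤ g / 2 - 1 := by
    by_cases hside : p < q ∧ 2 * (q - p) ≤ g ∨ q < p ∧ g ≤ 2 * (p - q)
    · by_cases hc : g / 2 - 1 ≤ p
      · refine kOf_le_of_canonical hG h hcan (c := p - (g / 2 - 1)) (by omega) fun s hsS => ?_
        have := hgeo s hsS
        have := h.coords.pos_lt s
        omega
      · refine kOf_le_of_canonical hG h hcan (c := p + g - (g / 2 - 1)) (by omega) fun s hsS => ?_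
        have := hgeo s hsS
        have := h.coords.pos_lt s
        omega
    · refine kOf_le_of_canonical hG h hcan hp fun s hsS => ?_
      have := hgeo s hsS
      omega
  have h0 := hgeo s₀ hs₀
  have h1 := hgeo s₁ hs₁
  rw [hp₀] at h0
  rw [hp₁] at h1
  exact ⟨hkle, p, by omega, ht⟩

lemma config_of_offset (hG : IsUnicyclic G) (h : LabelCoords G g vc pos)
    (hcan : Canonical G g vc S) (hbi : Biactive G g vc S) {p q δ : ℕ} (hp : p < g) (hq : q < g)
    (hpq : p ≠ q) (hδ : δ < cycDist g p q)
    (hs : ∀ s ∈ S, cycDist g (pos s) p = cycDist g (pos s) q + δ)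
    (ht : 0 < δ → ∃ t, IsThreadAt G (vc q) t ∧ SFree S t ∧ δ ≤ t.length) :
    ConfigA G g vc S ∨ ConfigC G g vc S := by
  obtain ⟨hk, ⟨s₀, hs₀, hp₀⟩, ⟨s₁, hs₁, hp₁⟩, hle, hkg, htwo⟩ := canonical_spec h hcan hbi
  have h0 := hs s₀ hs₀
  have h1 := hs s₁ hs₁
  rw [hp₀] at h0
  rw [hp₁] at h1
  have haS : ∀ s ∈ S, pos s = 0 ∨ pos s = kOf G g vc S := by
    intro s hsS
    have h2 := hs s hsS
    have h3 := h.coords.pos_lt s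
    rcases Nat.lt_or_gt_of_ne hpq with hlt | hlt
    · have e0 := cycDist_eq_add_imp (by omega) hp hq hlt hδ h0
      have e1 := cycDist_eq_add_imp (by omega) hp hq hlt hδ h1
      have e2 := cycDist_eq_add_imp (by omega) hp hq hlt hδ h2
      omega
    · have e0 := cycDist_eq_add_imp' (by omega) hp hq hlt hδ h0
      have e1 := cycDist_eq_add_imp' (by omega) hp hq hlt hδ h1
      have e2 := cycDist_eq_add_imp' (by omega) hp hq hlt hδ h2
      omega
  have hk2 : kOf G g vc S ≤ g - kOf G g vc S := by
    refine kOf_le_of_canonical hG h hcan hkg fun s hsS => ?_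
    have := haS s hsS
    omega
  have hparity : Even g ∧ (δ = 0 ∧ kOf G g vc S = g / 2 ∨
      0 < δ ∧ kOf G g vc S + δ = g / 2 ∧ q ≤ kOf G g vc S) := by
    rw [Nat.even_iff]
    clear ht hs htwo haS hle
    rcases Nat.lt_or_gt_of_ne hpq with hlt | hlt
    · have e0 := cycDist_eq_add_imp (by omega) hp hq hlt hδ h0
      have e1 := cycDist_eq_add_imp (by omega) hp hq hlt hδ h1
      rw [cycDist_of_le hlt.le] at hδ
      omega
    · have e0 := cycDist_eq_add_imp' (by omega) hp hq hlt hδ h0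
      have e1 := cycDist_eq_add_imp' (by omega) hp hq hlt hδ h1
      rw [cycDist_comm, cycDist_of_le hlt.le] at hδ
      omega
  obtain ⟨heven, ⟨-, hkA⟩ | ⟨hδ0, hkC, hqk⟩⟩ := hparity
  · exact Or.inl ⟨htwo.2 haS, heven, hkA⟩
  · obtain ⟨t, h1, h2, h3⟩ := ht hδ0
    exact Or.inr ⟨htwo.2 haS, heven, by omega, q, hqk, t, h1, h2, by omega⟩

/-- A biactive branch-resolving set that contains no configuration is a metric generator. -/
lemma containsABC_of_not_isVertexMG (hG : IsUnicyclic G) (hg : 3 ≤ g)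
    (hvc : IsCycleLabelling G g vc) (hS : BranchResolving G S) (hbi : Biactive G g vc S)
    (hn : ¬ IsVertexMG G S) : ContainsABC G g vc S := by
  simp only [IsVertexMG, not_forall, not_exists, not_and, not_not] at hn
  obtain ⟨x, y, hne, hxy⟩ := hn
  obtain ⟨pos₀, h₀⟩ := exists_labelCoords hG hg hvc
  obtain ⟨a₀, ha₀, -⟩ := h₀.biactive_iff.1 hbi
  obtain ⟨vc', hvc', hr, hcan⟩ := exists_canonical hG hg hvc (S := S) ⟨a₀, ha₀⟩
  have hbi' := (biactive_congr hG hg hvc hvc').1 hbi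
  obtain ⟨pos, h⟩ := exists_labelCoords hG hg hvc'
  obtain ⟨a, ha, b, hb, hab⟩ := h.biactive_iff.1 hbi'
  rcases h.coords.undistinguished_cases hS ha hb hab hne hxy with
    ⟨p, q, hp, hq, hpq, ht, hs⟩ | ⟨p, q, δ, hp, hq, hpq, hδ, hs, ht⟩
  · exact Or.inr (Or.inl ⟨vc', hvc', hr, hcan, configB_of_geodesic hG h hcan hbi' hp hq hpq ht hs⟩)
  · rcases config_of_offset hG h hcan hbi' hp hq hpq hδ hs ht with hc | hc
    · exact Or.inl ⟨vc', hvc', hr, hcan, hc⟩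
    · exact Or.inr (Or.inr ⟨vc', hvc', hr, hcan, hc⟩)

end Configurations

section Generators

variable {V : Type*} {G : SimpleGraph V} {g : ℕ} {vc : ZMod g → V} {pos : V → ℕ} {S : Set V}

lemma IsVertexMG.biactive (h : LabelCoords G g vc pos) (hS : IsVertexMG G S) :
    Biactive G g vc S := by
  by_contra hcon
  rw [h.biactive_iff] at hcon
  push Not at hcon
  have hg := h.coords.three_le
  obtain ⟨i, hi, hSi⟩ : ∃ i < g, ∀ s ∈ S, pos s = i := by
    rcases S.eq_empty_or_nonempty with rfl | ⟨s₀, hs₀⟩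
    · exact ⟨0, by omega, by simp⟩
    · exact ⟨pos s₀, h.coords.pos_lt s₀, fun s hs => hcon s hs s₀ hs₀⟩
  obtain ⟨j, k, hj, hk, hjk, hji, hki, haj, hak⟩ := h.coords.exists_adj_cycle hi
  have hdist : ∀ j < g, j ≠ i → G.Adj (vc i) (vc j) → cycDist g i j = 1 := by
    intro j hj hji hadj
    have := (h.coords.eq_of_adj _ _ hadj (by
      rw [h.coords.pos_cycle i hi, h.coords.pos_cycle j hj]
      exact hji.symm)).2.2
    rwa [h.coords.pos_cycle i hi, h.coords.pos_cycle j hj] at this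
  obtain ⟨s, hs, hd⟩ := hS (vc j) (vc k) fun he => hjk (natCast_inj_of_lt hj hk (h.label.1 he))
  rw [h.coords.dist_cycle_vertex hj, h.coords.dist_cycle_vertex hk, hSi s hs, hdist j hj hji haj,
    hdist k hk hki hak] at hd
  exact hd rfl

lemma IsVertexMG.not_antipodal (h : LabelCoords G g vc pos) (hS : IsVertexMG G S)
    (heven : Even g) (hpos : ∀ s ∈ S, pos s = 0 ∨ pos s = g / 2) : False := by
  have hg := h.coords.three_le
  rw [Nat.even_iff] at heven
  obtain ⟨s, hs, hd⟩ := hS (vc (1 : ℕ)) (vc (g - 1 : ℕ)) fun he => by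
    have := natCast_inj_of_lt (by omega) (by omega) (h.label.1 he)
    omega
  rw [h.coords.dist_cycle_vertex (by omega), h.coords.dist_cycle_vertex (by omega)] at hd
  have := hpos s hs
  simp only [cycDist] at hd
  omega

variable [Fintype V] [DecidableRel G.Adj]

lemma IsVertexMG.branchResolving (hc : G.Connected) (hS : IsVertexMG G S) :
    BranchResolving G S := by
  intro v t₁ t₂ h₁ h₂ hne
  by_contra hcon
  push Not at hcon
  obtain ⟨hf₁, hf₂⟩ := hcon
  cases t₁ with
  | nil => exact absurd rfl h₁.isTail.ne_nil
  | cons c₁ r₁ =>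
    cases t₂ with
    | nil => exact absurd rfl h₂.isTail.ne_nil
    | cons c₂ r₂ =>
      have hcc : c₁ ≠ c₂ := by
        rintro rfl
        exact hne (h₁.eq_of_mem hc h₂ List.mem_cons_self List.mem_cons_self).2
      obtain ⟨s, hs, hd⟩ := hS c₁ c₂ hcc
      rw [h₁.isTail.dist_head hc (hf₁ s hs), h₂.isTail.dist_head hc (hf₂ s hs)] at hd
      exact hd rfl

lemma ne_cycle_of_mem_thread (h : LabelCoords G g vc pos) {v x : V} {t : List V}
    (ht : IsThreadAt G v t) (hx : x ∈ t) {j : ℕ} (hj : j < g) : x ≠ vc j := by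
  rintro rfl
  have := h.coords.ne_cycle_of_mem_tail ht.isTail _ hx
  rw [h.coords.pos_cycle j hj] at this
  exact this rfl

/-- A metric generator contains none of the configurations. -/
lemma IsVertexMG.not_containsABC (hG : IsUnicyclic G) (hg : 3 ≤ g) (hS : IsVertexMG G S) :
    ¬ ContainsABC G g vc S := by
  rintro (⟨vc', hvc', -, hcan, hA⟩ | ⟨vc', hvc', -, hcan, hB⟩ | ⟨vc', hvc', -, hcan, hC⟩)
  all_goals
    obtain ⟨pos, h⟩ := exists_labelCoords hG hg hvc'
    obtain ⟨hk, -, -, hle, hkg, htwo⟩ := canonical_spec h hcan (hS.biactive h)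
  · obtain ⟨ha, heven, hkA⟩ := hA
    exact hS.not_antipodal h heven (hkA ▸ htwo.1 ha)
  · obtain ⟨hkB, i, hi, t, ht, hfree⟩ := hB
    have hig : i < g := by omega
    obtain ⟨j, hj, hji⟩ : ∃ j < g, ∀ a ≤ kOf G g vc' S, cycDist g a j = cycDist g a i + 1 := by
      rcases hi with hi | hi | hi
      · refine ⟨i + 1, by omega, fun a ha => ?_⟩
        simp only [cycDist]
        omega
      · refine ⟨i - 1, by omega, fun a ha => ?_⟩
        simp only [cycDist]
        omega
      · refine ⟨g - 1, by omega, fun a ha => ?_⟩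
        simp only [cycDist]
        omega
    have hlen := List.length_pos_of_ne_nil ht.isTail.ne_nil
    obtain ⟨s, hs, hd⟩ := hS t[0] (vc' j) (ne_cycle_of_mem_thread h ht (List.getElem_mem _) hj)
    rw [ht.isTail.dist_getElem hG.1 (fun hst => hfree s hst hs), h.coords.dist_cycle_vertex hj,
      h.coords.dist_cycle_vertex hig, hji _ (hle s hs)] at hd
    omega
  · obtain ⟨ha, heven, hkC, i, hi, t, ht, hfree, hlen⟩ := hC
    rcases hkC.eq_or_lt with hk2 | hk2
    · exact hS.not_antipodal h heven (hk2 ▸ htwo.1 ha)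
    have hj : g / 2 + kOf G g vc' S - i < g := by omega
    have hn : g / 2 - kOf G g vc' S - 1 < t.length := by omega
    obtain ⟨s, hs, hd⟩ := hS t[g / 2 - kOf G g vc' S - 1] (vc' (g / 2 + kOf G g vc' S - i : ℕ))
      (ne_cycle_of_mem_thread h ht (List.getElem_mem _) hj)
    rw [ht.isTail.dist_getElem hG.1 (fun hst => hfree s hst hs), h.coords.dist_cycle_vertex hj,
      h.coords.dist_cycle_vertex (by omega)] at hd
    have hs' := htwo.1 ha s hs
    rw [Nat.even_iff] at heven
    clear hfree ht htwo hle hn hlen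
    simp only [cycDist] at hd
    rcases hs' with hs' | hs' <;> rw [hs'] at hd <;> omega

lemma BranchResolving.mono {S' : Set V} (hS : BranchResolving G S) (hsub : S ⊆ S') :
    BranchResolving G S' := by
  intro v t₁ t₂ h₁ h₂ hne
  rcases hS v t₁ t₂ h₁ h₂ hne with ⟨s, hs, hst⟩ | ⟨s, hs, hst⟩
  · exact Or.inl ⟨s, hsub hs, hst⟩
  · exact Or.inr ⟨s, hsub hs, hst⟩

/-- A branch-resolving set with three active vertices that split the cycle into arcs of length
at most `g / 2` is a metric generator. -/
lemma isVertexMG_of_three (h : LabelCoords G g vc pos) (hS : BranchResolving G S) {a b c : V}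
    (ha : a ∈ S) (hb : b ∈ S) (hc : c ∈ S) (hab : pos a < pos b) (hbc : pos b < pos c)
    (hab' : 2 * (pos b - pos a) ≤ g) (hbc' : 2 * (pos c - pos b) ≤ g)
    (hca' : g ≤ 2 * (pos c - pos a)) : IsVertexMG G S := by
  intro x y hne
  by_contra hcon
  push Not at hcon
  have hag := h.coords.pos_lt a
  have hbg := h.coords.pos_lt b
  have hcg := h.coords.pos_lt c
  rcases h.coords.undistinguished_cases hS ha hb hab.ne hne hcon with
    ⟨p, q, hp, hq, hpq, -, hs⟩ | ⟨p, q, δ, hp, hq, hpq, hδ, hs, -⟩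
  · have e1 := cycDist_geodesic hag hp hq hpq (hs a ha)
    have e2 := cycDist_geodesic hbg hp hq hpq (hs b hb)
    have e3 := cycDist_geodesic hcg hp hq hpq (hs c hc)
    clear hs hcon
    omega
  · rcases Nat.lt_or_gt_of_ne hpq with hlt | hlt
    · have e1 := cycDist_eq_add_imp hag hp hq hlt hδ (hs a ha)
      have e2 := cycDist_eq_add_imp hbg hp hq hlt hδ (hs b hb)
      have e3 := cycDist_eq_add_imp hcg hp hq hlt hδ (hs c hc)
      clear hs hcon
      omega
    · have e1 := cycDist_eq_add_imp' hag hp hq hlt hδ (hs a ha)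
      have e2 := cycDist_eq_add_imp' hbg hp hq hlt hδ (hs b hb)
      have e3 := cycDist_eq_add_imp' hcg hp hq hlt hδ (hs c hc)
      clear hs hcon
      omega

/-- One additional vertex turns a biactive branch-resolving set into a metric generator. -/
lemma exists_isVertexMG_insert (h : LabelCoords G g vc pos) (hS : BranchResolving G S)
    (hbi : Biactive G g vc S) : ∃ v, IsVertexMG G (insert v S) := by
  obtain ⟨a, ha, b, hb, hab⟩ : ∃ a ∈ S, ∃ b ∈ S, pos a < pos b := by
    obtain ⟨a, ha, b, hb, hab⟩ := h.biactive_iff.1 hbi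
    rcases Nat.lt_or_gt_of_ne hab with hlt | hlt
    · exact ⟨a, ha, b, hb, hlt⟩
    · exact ⟨b, hb, a, ha, hlt⟩
  have hg := h.coords.three_le
  have hbg := h.coords.pos_lt b
  have hpos : ∀ m : ℕ, m < g → pos (vc m) = m := h.coords.pos_cycle
  have hS' : ∀ v, BranchResolving G (insert v S) := fun v => hS.mono (Set.subset_insert v S)
  have haS : ∀ v, a ∈ insert v S := fun v => Set.mem_insert_of_mem v ha
  have hbS : ∀ v, b ∈ insert v S := fun v => Set.mem_insert_of_mem v hb
  by_cases hle : 2 * (pos b - pos a) ≤ g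
  · by_cases hlt : pos b + (g - (pos b - pos a)) / 2 < g
    · have := hpos _ hlt
      exact ⟨_, isVertexMG_of_three h (hS' _) (haS _) (hbS _)
        (Set.mem_insert (vc (pos b + (g - (pos b - pos a)) / 2 : ℕ)) S) hab
        (by omega) hle (by omega) (by omega)⟩
    · have := hpos (pos b + (g - (pos b - pos a)) / 2 - g) (by omega)
      exact ⟨_, isVertexMG_of_three h (hS' _)
        (Set.mem_insert (vc (pos b + (g - (pos b - pos a)) / 2 - g : ℕ)) S) (haS _) (hbS _)
        (by omega) hab (by omega) hle (by omega)⟩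
  · have := hpos (pos a + (pos b - pos a) / 2) (by omega)
    exact ⟨_, isVertexMG_of_three h (hS' _) (haS _)
      (Set.mem_insert (vc (pos a + (pos b - pos a) / 2 : ℕ)) S) (hbS _)
      (by omega) (by omega) (by omega) (by omega) (by omega)⟩

end Generators

section Counting

variable {V : Type*} {G : SimpleGraph V} {g : ℕ} {vc : ZMod g → V} {pos : V → ℕ} {S : Set V}

lemma mem_range_iff (h : LabelCoords G g vc pos) {x : V} :
    x ∈ Set.range vc ↔ x = vc (pos x) := by
  constructor
  · rintro ⟨i, rfl⟩
    obtain ⟨n, hn, rfl⟩ := exists_natCast_eq h.coords.three_le i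
    rw [h.coords.pos_cycle n hn]
  · intro hx
    exact ⟨_, hx.symm⟩

variable [Fintype V] [DecidableRel G.Adj]

lemma bG_eq (h : LabelCoords G g vc pos) :
    bG G g vc = (pos '' {x | Branching G g vc x}).ncard := by
  rw [← h.aS_eq]
  simp only [bG, BranchActive, aS, SActive, Set.mem_ofPred_eq, and_comm]

lemma exists_pair_isChild {u : ℕ → V} {x : V} {B : Finset V}
    (hB : ∀ z, G.Adj x z → ¬ IsChild G u pos x z → z ∈ B) (hdeg : B.card + 2 ≤ G.degree x) :
    ∃ c c', IsChild G u pos x c ∧ IsChild G u pos x c' ∧ c ≠ c' := by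
  classical
  have hcard : 1 < (G.neighborFinset x \ B).card := by
    have := Finset.le_card_sdiff B (G.neighborFinset x)
    rw [card_neighborFinset_eq_degree] at this
    omega
  obtain ⟨c, hc, c', hc', hne⟩ := Finset.one_lt_card.1 hcard
  simp only [Finset.mem_sdiff, mem_neighborFinset] at hc hc'
  exact ⟨c, c', by_contra fun hcc => hc.2 (hB c hc.1 hcc),
    by_contra fun hcc => hc'.2 (hB c' hc'.1 hcc), hne⟩

/-- A branching vertex has two children. -/
lemma exists_children_of_branching (h : LabelCoords G g vc pos) {x : V}
    (hx : Branching G g vc x) : ∃ c c', IsChild G (fun n => vc n) pos x c ∧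
      IsChild G (fun n => vc n) pos x c' ∧ c ≠ c' := by
  classical
  rcases hx with ⟨hx, hdeg⟩ | ⟨hx, hdeg⟩
  · rw [mem_range_iff h] at hx
    obtain ⟨w, hw, hwx⟩ := h.coords.exists_adj_not_isChild x
    have parent : ∀ z, G.Adj x z → ¬ IsChild G (fun n => vc n) pos x z →
        IsChild G (fun n => vc n) pos z x := fun z hz hzx =>
      (h.coords.isChild_or hz (h.coords.pos_eq_of_adj hz.symm hx).symm).resolve_left hzx
    refine exists_pair_isChild (B := {w}) (fun z hz hzx => ?_) (by simpa using hdeg)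
    rw [Finset.mem_singleton]
    exact h.coords.parent_unique (parent z hz hzx) (parent w hw hwx)
  · rw [mem_range_iff h] at hx
    have hg := h.coords.three_le
    have hpx := h.coords.pos_lt x
    refine exists_pair_isChild
      (B := {vc (if pos x = 0 then g - 1 else pos x - 1 : ℕ),
        vc (if pos x = g - 1 then 0 else pos x + 1 : ℕ)}) (fun z hz hzx => ?_) ?_
    · have hne : pos x ≠ pos z := by
        intro he
        have := ((h.coords.isChild_or hz he).resolve_left hzx).2.2
        rw [h.coords.height_eq_zero.2 hx] at this
        omega
      obtain ⟨-, h1, h2⟩ := h.coords.eq_of_adj x z hz hne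
      have hpz := h.coords.pos_lt z
      have : pos z = (if pos x = 0 then g - 1 else pos x - 1 : ℕ) ∨
          pos z = (if pos x = g - 1 then 0 else pos x + 1 : ℕ) := by
        simp only [cycDist] at h2
        split_ifs <;> omega
      rw [Finset.mem_insert, Finset.mem_singleton]
      refine this.imp (fun he => ?_) (fun he => ?_)
      · rw [← he]
        exact h1
      · rw [← he]
        exact h1
    · have := Finset.card_le_two (a := vc (if pos x = 0 then g - 1 else pos x - 1 : ℕ))
        (b := vc (if pos x = g - 1 then 0 else pos x + 1 : ℕ))
      omega

/-- Branch-active vertices are active for every branch-resolving set. -/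
lemma exists_mem_of_branching (h : LabelCoords G g vc pos) (hS : BranchResolving G S) {x : V}
    (hx : Branching G g vc x) : ∃ s ∈ S, pos s = pos x := by
  obtain ⟨c, c', hc, hc', hne⟩ := exists_children_of_branching h hx
  obtain ⟨s, hs, hd | hd⟩ := h.coords.exists_mem_branch hS hc hc' hne
  · exact ⟨s, hs, (h.coords.branch_height hc hd).1⟩
  · exact ⟨s, hs, (h.coords.branch_height hc' hd).1⟩

lemma branching_of_two_threads (h : LabelCoords G g vc pos) {v : V} {t t' : List V}
    (ht : IsThreadAt G v t) (ht' : IsThreadAt G v t') (hne : t ≠ t') : Branching G g vc v := by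
  classical
  by_cases hv : v ∈ Set.range vc
  · refine Or.inr ⟨hv, ?_⟩
    rw [mem_range_iff h] at hv
    obtain ⟨j, k, hj, hk, hjk, -, -, haj, hak⟩ := h.coords.exists_adj_cycle (h.coords.pos_lt v)
    rw [← hv] at haj hak
    cases t with
    | nil => exact absurd rfl ht.isTail.ne_nil
    | cons c r =>
      cases t' with
      | nil => exact absurd rfl ht'.isTail.ne_nil
      | cons c' r' =>
        have hcc : c ≠ c' := by
          rintro rfl
          exact hne (ht.eq_of_mem h.coords.connected ht' List.mem_cons_self List.mem_cons_self).2
        have hoff : ∀ i < g, c ≠ vc i ∧ c' ≠ vc i := fun i hi =>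
          ⟨ne_cycle_of_mem_thread h ht List.mem_cons_self hi,
            ne_cycle_of_mem_thread h ht' List.mem_cons_self hi⟩
        have hjk' : vc j ≠ vc k := fun he => hjk (natCast_inj_of_lt hj hk (h.label.1 he))
        have hcard : ({c, c', vc j, vc k} : Finset V).card = 4 :=
          Finset.card_eq_four.2 ⟨_, _, _, _, hcc, (hoff j hj).1, (hoff k hk).1, (hoff j hj).2,
            (hoff k hk).2, hjk', rfl⟩
        rw [← card_neighborFinset_eq_degree, ← hcard]
        refine Finset.card_le_card fun z hz => ?_
        simp only [Finset.mem_insert, Finset.mem_singleton] at hz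
        rw [mem_neighborFinset]
        rcases hz with rfl | rfl | rfl | rfl
        · exact ht.isTail.adj
        · exact ht'.isTail.adj
        · exact haj
        · exact hak
  · exact Or.inl ⟨hv, ht.2.2.2.1⟩

/-- All but one of the threads hanging at a vertex contain a vertex of a branch-resolving set. -/
lemma numThreads_sub_one_le (hc : G.Connected) (hS : BranchResolving G S) (v : V) :
    numThreads G v - 1 ≤ {s ∈ S | ∃ t, IsThreadAt G v t ∧ s ∈ t}.ncard := by
  classical
  let free : Set (List V) := {t | IsThreadAt G v t ∧ SFree S t}
  have hfin := finite_threads (G := G) v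
  have hfree : free.ncard ≤ 1 := by
    rw [Set.ncard_le_one (hfin.subset fun t ht => ht.1)]
    intro t₁ h₁ t₂ h₂
    by_contra hne
    rcases hS v t₁ t₂ h₁.1 h₂.1 hne with ⟨s, hs, hst⟩ | ⟨s, hs, hst⟩
    · exact h₁.2 s hst hs
    · exact h₂.2 s hst hs
  have hdiff : numThreads G v - 1 ≤ ({t | IsThreadAt G v t} \ free).ncard := by
    have := Set.le_ncard_sdiff free {t | IsThreadAt G v t} (hfin.subset fun t ht => ht.1)
    rw [numThreads]
    omega
  have hmem : ∀ t ∈ {t | IsThreadAt G v t} \ free, ∃ s ∈ S, s ∈ t := by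
    rintro t ⟨ht, hnf⟩
    by_contra hcon
    push Not at hcon
    exact hnf ⟨ht, fun x hx hxS => hcon x hxS hx⟩
  have : Nonempty V := ⟨v⟩
  choose! f hfS hft using hmem
  refine hdiff.trans (Set.ncard_le_ncard_of_injOn f (fun t ht => ⟨hfS t ht, t, ht.1, hft t ht⟩) ?_
    (Set.toFinite _))
  intro t ht t' ht' he
  exact (IsThreadAt.eq_of_mem hc ht.1 ht'.1 (hft t ht) (he ▸ hft t' ht')).2

lemma le_card_of_biactive (h : LabelCoords G g vc pos) {S : Finset V}
    (hS : BranchResolving G (S : Set V)) (hbi : Biactive G g vc S) :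
    LG G + (2 - bG G g vc) ≤ S.card := by
  classical
  let A : Finset V := S.filter fun s => ∃ x, Branching G g vc x ∧ pos x = pos s
  have hLG : LG G ≤ A.card := by
    let M : V → Finset V := fun v => if numThreads G v ≤ 1 then ∅ else
      S.filter fun s => ∃ t, IsThreadAt G v t ∧ s ∈ t
    have hM : ∀ v s, s ∈ M v → s ∈ S ∧ (∃ t, IsThreadAt G v t ∧ s ∈ t) ∧ 1 < numThreads G v := by
      intro v s hs
      by_cases hv : numThreads G v ≤ 1
      · simp [M, hv] at hs
      · simp only [M, hv, if_false, Finset.mem_filter] at hs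
        exact ⟨hs.1, hs.2, not_le.1 hv⟩
    calc LG G ≤ ∑ v, (M v).card := by
          refine Finset.sum_le_sum fun v _ => ?_
          by_cases hv : numThreads G v ≤ 1
          · omega
          · have := numThreads_sub_one_le h.coords.connected hS v
            simp only [M, hv, if_false]
            rw [← Set.ncard_coe_finset]
            simpa using this
      _ = (Finset.univ.biUnion M).card := by
          refine (Finset.card_biUnion fun v _ v' _ hne => ?_).symm
          rw [Function.onFun, Finset.disjoint_left]
          intro s hs hs'
          obtain ⟨-, ⟨t, ht, hst⟩, -⟩ := hM v s hs
          obtain ⟨-, ⟨t', ht', hst'⟩, -⟩ := hM v' s hs'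
          exact hne (ht.eq_of_mem h.coords.connected ht' hst hst').1
      _ ≤ A.card := by
          refine Finset.card_le_card fun s hs => ?_
          obtain ⟨v, -, hv⟩ := Finset.mem_biUnion.1 hs
          obtain ⟨hsS, ⟨t, ht, hst⟩, hnum⟩ := hM v s hv
          obtain ⟨t₁, h₁, t₂, h₂, hne⟩ := (Set.one_lt_ncard (finite_threads v)).1 hnum
          exact Finset.mem_filter.2 ⟨hsS, v, branching_of_two_threads h h₁ h₂ hne,
            (h.coords.pos_of_mem_tail ht.isTail s hst).symm⟩
  have hb : 2 ≤ bG G g vc + (S \ A).card := by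
    have h1 : 2 ≤ aS G g vc (S : Set V) := hbi
    rw [h.aS_eq] at h1
    rw [bG_eq h]
    have hsub : pos '' (S : Set V) ⊆
        pos '' {x | Branching G g vc x} ∪ (((S \ A).image pos : Finset ℕ) : Set ℕ) := by
      rintro _ ⟨s, hs, rfl⟩
      by_cases hA : s ∈ A
      · obtain ⟨-, x, hx, hxs⟩ := Finset.mem_filter.1 hA
        exact Or.inl ⟨x, hx, hxs⟩
      · refine Or.inr ?_
        rw [Finset.mem_coe]
        exact Finset.mem_image_of_mem _ (Finset.mem_sdiff.2 ⟨hs, hA⟩)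
    have h2 := Set.ncard_le_ncard hsub (h.finite_image.union (Finset.finite_toSet _))
    have h3 := Set.ncard_union_le (pos '' {x | Branching G g vc x})
      (((S \ A).image pos : Finset ℕ) : Set ℕ)
    rw [Set.ncard_coe_finset] at h3
    have h4 := Finset.card_image_le (s := S \ A) (f := pos)
    omega
  have hsplit := Finset.card_sdiff_add_card_eq_card (show A ⊆ S from Finset.filter_subset _ S)
  omega

lemma exists_branchResolving_card_le (G : SimpleGraph V) [DecidableRel G.Adj] :
    ∃ S : Finset V, BranchResolving G (S : Set V) ∧ S.card ≤ LG G := by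
  classical
  have local_choice : ∀ v, ∃ H : Finset V, H.card ≤ numThreads G v - 1 ∧
      ∀ t₁ t₂, IsThreadAt G v t₁ → IsThreadAt G v t₂ → t₁ ≠ t₂ →
        (∃ s ∈ H, s ∈ t₁) ∨ ∃ s ∈ H, s ∈ t₂ := by
    intro v
    by_cases hne : ∃ t, IsThreadAt G v t
    · obtain ⟨t, ht⟩ := hne
      have hfin := finite_threads (G := G) v
      have hmem : ∀ t', t' ≠ t → IsThreadAt G v t' →
          ∃ s ∈ (hfin.toFinset.erase t).image fun t => t.headD v, s ∈ t' := by
        intro t' hne ht'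
        refine ⟨t'.headD v, Finset.mem_image_of_mem _ (by simpa using ⟨hne, ht'⟩), ?_⟩
        cases t' with
        | nil => exact absurd rfl ht'.isTail.ne_nil
        | cons c r => simp
      refine ⟨(hfin.toFinset.erase t).image fun t => t.headD v, ?_, ?_⟩
      · refine Finset.card_image_le.trans ?_
        rw [Finset.card_erase_of_mem (by simpa using ht), numThreads,
          Set.ncard_eq_toFinset_card _ hfin]
      · intro t₁ t₂ h₁ h₂ h₁₂
        by_cases he : t₁ = t
        · exact Or.inr (hmem t₂ (fun he' => h₁₂ (he.trans he'.symm)) h₂)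
        · exact Or.inl (hmem t₁ he h₁)
    · push Not at hne
      exact ⟨∅, by simp, fun t₁ _ h₁ => absurd h₁ (hne t₁)⟩
  choose H hcard hH using local_choice
  refine ⟨Finset.univ.biUnion H, ?_, Finset.card_biUnion_le.trans
    (Finset.sum_le_sum fun v _ => hcard v)⟩
  intro v t₁ t₂ h₁ h₂ hne
  have hmem : ∀ s ∈ H v, s ∈ ((Finset.univ.biUnion H : Finset V) : Set V) := fun s hs =>
    Finset.mem_coe.2 (Finset.mem_biUnion.2 ⟨v, Finset.mem_univ v, hs⟩)
  rcases hH v t₁ t₂ h₁ h₂ hne with ⟨s, hs, hst⟩ | ⟨s, hs, hst⟩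
  · exact Or.inl ⟨s, hmem s hs, hst⟩
  · exact Or.inr ⟨s, hmem s hs, hst⟩

lemma exists_biactive_card_le (h : LabelCoords G g vc pos) :
    ∃ S : Finset V, BranchResolving G (S : Set V) ∧ Biactive G g vc S ∧
      S.card ≤ LG G + (2 - bG G g vc) := by
  classical
  obtain ⟨S, hS, hcard⟩ := exists_branchResolving_card_le G
  have hg := h.coords.three_le
  let B : Finset ℕ := (h.finite_image (S := {x | Branching G g vc x})).toFinset
  have hB : bG G g vc = B.card := by
    rw [bG_eq h, Set.ncard_eq_toFinset_card _ h.finite_image]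
  obtain ⟨J, hJ, hJcard⟩ : ∃ J ⊆ Finset.range g \ B, J.card = 2 - bG G g vc := by
    refine Finset.exists_subset_card_eq ?_
    have := Finset.le_card_sdiff B (Finset.range g)
    rw [Finset.card_range] at this
    omega
  have hsub : S ⊆ S ∪ J.image fun n : ℕ => vc n := Finset.subset_union_left
  refine ⟨S ∪ J.image fun n : ℕ => vc n, hS.mono (by exact_mod_cast hsub), ?_, ?_⟩
  · rw [Biactive, h.aS_eq]
    have hBJ : ((B ∪ J : Finset ℕ) : Set ℕ) ⊆
        pos '' ((S ∪ J.image fun n : ℕ => vc n : Finset V) : Set V) := by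
      intro n hn
      rcases Finset.mem_union.1 (Finset.mem_coe.1 hn) with hn | hn
      · obtain ⟨x, hx, rfl⟩ := (Set.Finite.mem_toFinset _).1 hn
        obtain ⟨s, hs, hsx⟩ := exists_mem_of_branching h hS hx
        exact ⟨s, Finset.mem_coe.2 (hsub hs), hsx⟩
      · have hng := Finset.mem_range.1 (Finset.mem_sdiff.1 (hJ hn)).1
        exact ⟨vc n, Finset.mem_coe.2 (Finset.mem_union_right _ (Finset.mem_image_of_mem _ hn)),
          h.coords.pos_cycle n hng⟩
    have h1 := Set.ncard_le_ncard hBJ h.finite_image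
    rw [Set.ncard_coe_finset, Finset.card_union_of_disjoint
      (Finset.disjoint_left.2 fun n hn hn' => (Finset.mem_sdiff.1 (hJ hn')).2 hn)] at h1
    omega
  · refine (Finset.card_union_le _ _).trans (Nat.add_le_add hcard ?_)
    exact hJcard ▸ Finset.card_image_le

lemma SmallestBBR.card_eq (h : LabelCoords G g vc pos) {S : Finset V}
    (hS : SmallestBBR G g vc S) : S.card = LG G + (2 - bG G g vc) := by
  obtain ⟨S', h1, h2, h3⟩ := exists_biactive_card_le h
  exact ((hS.2.2 S' h1 h2).trans h3).antisymm (le_card_of_biactive h hS.1 hS.2.1)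

end Counting

lemma metricDim_eq {V : Type*} {G : SimpleGraph V} {S : Finset V}
    (hS : IsVertexMG G (S : Set V))
    (hmin : ∀ S' : Finset V, IsVertexMG G (S' : Set V) → S.card ≤ S'.card) :
    metricDim G = S.card := by
  refine le_antisymm (Nat.sInf_le ⟨S, rfl, hS⟩) (le_csInf ⟨_, S, rfl, hS⟩ ?_)
  rintro _ ⟨S', rfl, hS'⟩
  exact hmin S' hS'

theorem statement_6 {V : Type*} [Fintype V] [DecidableEq V] (G : SimpleGraph V)
    [DecidableRel G.Adj] (hG : IsUnicyclic G) (g : ℕ) (hg : 3 ≤ g)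
    (vc : ZMod g → V) (hvc : IsCycleLabelling G g vc) :
    (ABCneg G g vc → metricDim G = LG G + max 0 (2 - bG G g vc)) ∧
    (¬ ABCneg G g vc → metricDim G = LG G + max 0 (2 - bG G g vc) + 1) := by
  obtain ⟨pos, h⟩ := exists_labelCoords hG hg hvc
  rw [max_eq_right (Nat.zero_le _)]
  have lower : ∀ S : Finset V, IsVertexMG G (S : Set V) →
      LG G + (2 - bG G g vc) ≤ S.card := fun S hS =>
    le_card_of_biactive h (hS.branchResolving hG.1) (hS.biactive h)
  constructor
  · rintro ⟨S, hS, hABC⟩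
    have hMG : IsVertexMG G (S : Set V) :=
      by_contra fun hn => hABC (containsABC_of_not_isVertexMG hG hg hvc hS.1 hS.2.1 hn)
    rw [← hS.card_eq h] at lower ⊢
    exact metricDim_eq hMG lower
  · intro hneg
    obtain ⟨S, hBR, hbi, hcard⟩ := exists_biactive_card_le h
    obtain ⟨v, hv⟩ := exists_isVertexMG_insert h hBR hbi
    have hMG : IsVertexMG G ((insert v S : Finset V) : Set V) := by
      rwa [Finset.coe_insert]
    have lower' : ∀ S' : Finset V, IsVertexMG G (S' : Set V) →
        LG G + (2 - bG G g vc) + 1 ≤ S'.card := by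
      intro S' hS'
      refine Nat.succ_le_of_lt ((lower S' hS').lt_of_ne fun he => hneg ⟨S', ⟨?_, ?_, ?_⟩, ?_⟩)
      · exact hS'.branchResolving hG.1
      · exact hS'.biactive h
      · intro S'' h1 h2
        rw [← he]
        exact le_card_of_biactive h h1 h2
      · exact hS'.not_containsABC hG hg
    have heq : (insert v S).card = LG G + (2 - bG G g vc) + 1 :=
      ((Finset.card_insert_le v S).trans (by omega)).antisymm (lower' _ hMG)
    rw [← heq] at lower' ⊢
    exact metricDim_eq hMG lower'
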